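/- arXiv:1503.04408 — 2 statements merged into one kernel-verified Lean document; each statement's English description precedes it below -/
import Mathlib

section
/- For any choice of positive integers d, a, b, c with d > a, d > b, d > c, a general homogeneous form of degree d in four variables over ℂ can be written as F_1 + F_2, where F_1 and F_2 are forms of degree d such that each of the surfaces {F_1 = 0} and {F_2 = 0} in ℙ³ contains a complete intersection set of points of type (a, b, c), i.e. the ideal of F_i contains a regular sequence of three forms of degrees a, b, c. -/
open MvPolynomial

/-- `g₁, g₂, g₃` is a regular sequence in the polynomial ring: each is a nonzerodivisor
modulo the ideal generated by the previous ones. -/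
def IsRegSeq {σ : Type*} (g₁ g₂ g₃ : MvPolynomial σ ℂ) : Prop :=
  (∀ h, g₁ * h = 0 → h = 0) ∧
  (∀ h, g₂ * h ∈ Ideal.span {g₁} → h ∈ Ideal.span {g₁}) ∧
  (∀ h, g₃ * h ∈ Ideal.span ({g₁, g₂} : Set (MvPolynomial σ ℂ)) →
    h ∈ Ideal.span ({g₁, g₂} : Set (MvPolynomial σ ℂ)))

/-- The surface `{F = 0}` in `ℙ³` contains a complete intersection set of points of type
`(a, b, c)`: `F` lies in an ideal generated by a regular sequence of three homogeneous
forms of degrees `a`, `b`, `c`. -/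
def ContainsCI (F : MvPolynomial (Fin 4) ℂ) (a b c : ℕ) : Prop :=
  ∃ g₁ g₂ g₃ : MvPolynomial (Fin 4) ℂ,
    g₁.IsHomogeneous a ∧ g₂.IsHomogeneous b ∧ g₃.IsHomogeneous c ∧
    IsRegSeq g₁ g₂ g₃ ∧
    F ∈ Ideal.span ({g₁, g₂, g₃} : Set (MvPolynomial (Fin 4) ℂ))

/-- Each monomial `X ^ n` with every full factor `X i ^ e i` replaced by `f i`. -/
noncomputable def substDivMod {σ B : Type*} [Fintype σ] [CommRing B] (e : σ → ℕ)
    (f : σ → MvPolynomial σ B) (n : σ →₀ ℕ) : MvPolynomial σ B :=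
  ∏ i, f i ^ (n i / e i) * X i ^ (n i % e i)

section substDivMod

variable {σ B : Type*} [Fintype σ] [CommRing B] {e : σ → ℕ} {f : σ → MvPolynomial σ B}

theorem substDivMod_isHomogeneous (hf : ∀ i, (f i).IsHomogeneous (e i)) (n : σ →₀ ℕ) :
    (substDivMod e f n).IsHomogeneous n.degree := by
  rw [Finsupp.degree_eq_sum]
  refine IsHomogeneous.prod _ _ _ fun i _ => ?_
  have h := ((hf i).pow (n i / e i)).mul (isHomogeneous_X_pow (R := B) i (n i % e i))
  rwa [Nat.div_add_mod] at h

theorem substDivMod_X_pow (n : σ →₀ ℕ) :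
    substDivMod e (fun i => (X i : MvPolynomial σ B) ^ e i) n = monomial n 1 := by
  rw [monomial_eq, C_1, one_mul, Finsupp.prod_fintype _ _ (by simp)]
  refine Finset.prod_congr rfl fun i _ => ?_
  rw [← pow_mul, ← pow_add, Nat.div_add_mod]

theorem map_substDivMod {A : Type*} [CommRing A] (φ : B →+* A) (n : σ →₀ ℕ) :
    map φ (substDivMod e f n) = substDivMod e (fun i => map φ (f i)) n := by
  simp [substDivMod, map_prod]

theorem substDivMod_add_single [DecidableEq σ] {i : σ} (he : 0 < e i) (n : σ →₀ ℕ) :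
    substDivMod e f (Finsupp.single i (e i) + n) = f i * substDivMod e f n := by
  unfold substDivMod
  rw [← Finset.mul_prod_erase _ _ (Finset.mem_univ i),
    ← Finset.mul_prod_erase Finset.univ (fun j => f j ^ (n j / e j) * X j ^ (n j % e j))
      (Finset.mem_univ i)]
  rw [Finset.prod_congr rfl (g := fun j => f j ^ (n j / e j) * X j ^ (n j % e j))]
  · simp only [Finsupp.add_apply, Finsupp.single_eq_same, Nat.add_div_left _ he,
      Nat.add_mod_left, pow_succ]
    ring
  · intro j hj
    have : i ≠ j := (Finset.ne_of_mem_erase hj).symm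
    simp [this]

variable (e f) in
/-- The linear extension of `substDivMod` to all polynomials. -/
noncomputable def substDivModLinear : MvPolynomial σ B →ₗ[B] MvPolynomial σ B :=
  (basisMonomials σ B).constr B (substDivMod e f)

theorem substDivModLinear_monomial (n : σ →₀ ℕ) :
    substDivModLinear e f (monomial n 1) = substDivMod e f n := by
  have := (basisMonomials σ B).constr_basis B (substDivMod e f) n
  rwa [coe_basisMonomials] at this

theorem substDivModLinear_X_pow_mul {i : σ} (he : 0 < e i) (p : MvPolynomial σ B) :
    substDivModLinear e f (X i ^ e i * p) = f i * substDivModLinear e f p := by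
  classical
  have : (substDivModLinear e f) ∘ₗ LinearMap.mulLeft B (X i ^ e i) =
      LinearMap.mulLeft B (f i) ∘ₗ substDivModLinear e f := by
    refine (basisMonomials σ B).ext fun n => ?_
    simp only [coe_basisMonomials, LinearMap.comp_apply, LinearMap.mulLeft_apply,
      substDivModLinear_monomial, X_pow_eq_monomial, monomial_mul, one_mul]
    exact substDivMod_add_single he n
  exact LinearMap.congr_fun this p

theorem substDivModLinear_isHomogeneous (hf : ∀ i, (f i).IsHomogeneous (e i)) {k : ℕ}
    {p : MvPolynomial σ B} (hp : p.IsHomogeneous k) :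
    (substDivModLinear e f p).IsHomogeneous k := by
  rw [p.as_sum, map_sum]
  refine IsHomogeneous.sum _ _ _ fun n hn => ?_
  have : monomial n (coeff n p) = coeff n p • monomial n (1 : B) := by
    rw [smul_monomial, smul_eq_mul, mul_one]
  rw [this, map_smul, substDivModLinear_monomial, smul_eq_C_mul]
  have hd : n.degree = k := by
    by_contra h
    exact (mem_support_iff.mp hn) (hp.coeff_eq_zero h)
  exact hd ▸ (substDivMod_isHomogeneous hf n).C_mul _

instance finite_degree_eq (k : ℕ) : Finite {n : σ →₀ ℕ // n.degree = k} :=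
  Finsupp.finite_of_degree_eq k

noncomputable instance fintype_degree_eq (k : ℕ) : Fintype {n : σ →₀ ℕ // n.degree = k} :=
  Fintype.ofFinite _

variable (e f) in
/-- The matrix of `substDivModLinear` on forms of degree `k`. -/
noncomputable def substDivModMatrix (k : ℕ) :
    Matrix {n : σ →₀ ℕ // n.degree = k} {n : σ →₀ ℕ // n.degree = k} B :=
  Matrix.of fun m n => coeff m.1 (substDivMod e f n.1)

open Classical in
variable (e f) in
/-- The product of the determinants of `substDivModLinear` in degrees at most `∑ i, e i`. -/
noncomputable def substDivModDet : B :=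
  ∏ k ∈ Finset.range (∑ i, e i + 1), (substDivModMatrix e f k).det

theorem map_substDivModDet {A : Type*} [CommRing A] (φ : B →+* A) :
    φ (substDivModDet e f) = substDivModDet e (fun i => map φ (f i)) := by
  classical
  unfold substDivModDet
  rw [map_prod]
  refine Finset.prod_congr rfl fun k _ => ?_
  rw [RingHom.map_det]
  congr 1
  ext m n
  simp [substDivModMatrix, ← map_substDivMod, coeff_map]

theorem substDivModDet_X_pow :
    substDivModDet e (fun i => (X i : MvPolynomial σ B) ^ e i) = 1 := by
  classical
  unfold substDivModDet
  refine Finset.prod_eq_one fun k _ => ?_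
  have : substDivModMatrix e (fun i => (X i : MvPolynomial σ B) ^ e i) k = 1 := by
    ext m n
    simp [substDivModMatrix, substDivMod_X_pow, coeff_monomial, Matrix.one_apply,
      Subtype.ext_iff, eq_comm]
  rw [this, Matrix.det_one]

end substDivMod

section Bijective

variable {σ K : Type*} [Fintype σ] [Field K] {e : σ → ℕ} {f : σ → MvPolynomial σ K}

theorem homogeneousSubmodule_le_map_of_det_ne_zero (hf : ∀ i, (f i).IsHomogeneous (e i))
    (hdet : substDivModDet e f ≠ 0) {k : ℕ} (hk : k ≤ ∑ i, e i) (m : σ →₀ ℕ)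
    (hm : m.degree = k) :
    ∃ q : MvPolynomial σ K, q.IsHomogeneous k ∧ substDivModLinear e f q = monomial m 1 := by
  classical
  have hu : IsUnit (substDivModMatrix e f k).det := by
    rw [isUnit_iff_ne_zero]
    exact (Finset.prod_ne_zero_iff.mp hdet) k (Finset.mem_range.mpr (by omega))
  set M := substDivModMatrix e f k with hM
  refine ⟨∑ n : {n : σ →₀ ℕ // n.degree = k}, monomial n.1 (M⁻¹ n ⟨m, hm⟩), ?_, ?_⟩
  · exact IsHomogeneous.sum _ _ _ fun n _ => isHomogeneous_monomial _ n.2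
  · have key : ∀ n : {n : σ →₀ ℕ // n.degree = k},
        substDivModLinear e f (monomial n.1 (M⁻¹ n ⟨m, hm⟩)) =
          M⁻¹ n ⟨m, hm⟩ • substDivMod e f n.1 := fun n => by
      rw [← substDivModLinear_monomial, ← map_smul, smul_monomial, smul_eq_mul, mul_one]
    rw [map_sum, Finset.sum_congr rfl fun n _ => key n]
    ext l
    rw [coeff_sum]
    simp only [coeff_smul, smul_eq_mul]
    by_cases hl : l.degree = k
    · have h1 := congrFun (congrFun (Matrix.mul_nonsing_inv M hu) ⟨l, hl⟩) ⟨m, hm⟩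
      rw [Matrix.mul_apply] at h1
      rw [coeff_monomial]
      simp only [Matrix.one_apply, Subtype.mk.injEq] at h1
      rw [Finset.sum_congr rfl fun n _ => mul_comm _ _]
      simp only [eq_comm (a := m)]
      rw [← h1]
      rfl
    · rw [coeff_monomial, if_neg (by rintro rfl; exact hl hm)]
      refine Finset.sum_eq_zero fun n _ => ?_
      rw [(substDivMod_isHomogeneous hf n.1).coeff_eq_zero (by rw [n.2]; exact hl), mul_zero]

theorem isHomogeneous_mem_map_substDivModLinear (he : ∀ i, 0 < e i)
    (hf : ∀ i, (f i).IsHomogeneous (e i)) (hdet : substDivModDet e f ≠ 0) (k : ℕ) :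
    ∀ p : MvPolynomial σ K, p.IsHomogeneous k →
      ∃ q : MvPolynomial σ K, q.IsHomogeneous k ∧ substDivModLinear e f q = p := by
  classical
  induction k using Nat.strong_induction_on with
  | _ k ih =>
  suffices H : ∀ m : σ →₀ ℕ, m.degree = k →
      ∃ q : MvPolynomial σ K, q.IsHomogeneous k ∧ substDivModLinear e f q = monomial m 1 by
    intro p hp
    choose! q hq hq' using H
    have hd : ∀ n ∈ p.support, n.degree = k := fun n hn => by
      by_contra h
      exact (mem_support_iff.mp hn) (hp.coeff_eq_zero h)
    refine ⟨∑ n ∈ p.support, coeff n p • q n, ?_, ?_⟩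
    · refine IsHomogeneous.sum _ _ _ fun n hn => ?_
      rw [smul_eq_C_mul]
      exact (hq n (hd n hn)).C_mul _
    · conv_rhs => rw [p.as_sum]
      rw [map_sum]
      refine Finset.sum_congr rfl fun n hn => ?_
      rw [map_smul, hq' n (hd n hn), smul_monomial, smul_eq_mul, mul_one]
  intro m hm
  by_cases hk : k ≤ ∑ i, e i
  · exact homogeneousSubmodule_le_map_of_det_ne_zero hf hdet hk m hm
  push Not at hk
  obtain ⟨m', hm'le, hm'⟩ : ∃ m' ≤ m, m'.degree = ∑ i, e i :=
    Finsupp.exists_le_degree_eq m _ (by omega)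
  obtain ⟨q, hq, hqm⟩ := homogeneousSubmodule_le_map_of_det_ne_zero hf hdet le_rfl m' hm'
  have hstep : ∀ n ∈ q.support, ∃ r : MvPolynomial σ K, r.IsHomogeneous k ∧
      substDivModLinear e f r = substDivMod e f n * monomial (m - m') 1 := by
    intro n hn
    have hnd : n.degree = ∑ i, e i := by
      by_contra h
      exact (mem_support_iff.mp hn) (hq.coeff_eq_zero h)
    have hpos : Nonempty σ := by
      by_contra h
      rw [not_nonempty_iff] at h
      rw [Finsupp.degree_eq_sum] at hm
      simp at hm
      omega
    obtain ⟨i, hi⟩ : ∃ i, e i ≤ n i := by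
      rw [Finsupp.degree_eq_sum] at hnd
      by_contra! h
      exact absurd hnd (Finset.sum_lt_sum_of_nonempty Finset.univ_nonempty fun i _ => h i).ne
    obtain ⟨n', rfl⟩ : ∃ n', n = Finsupp.single i (e i) + n' :=
      ⟨n - Finsupp.single i (e i), (add_tsub_cancel_of_le (Finsupp.single_le_iff.mpr hi)).symm⟩
    have hdeg : (e i) + n'.degree + (m - m').degree = k := by
      have h1 : m' + (m - m') = m := add_tsub_cancel_of_le hm'le
      have h2 := congrArg Finsupp.degree h1
      rw [map_add] at h2
      rw [map_add, Finsupp.degree_single] at hnd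
      omega
    obtain ⟨r, hr, hr'⟩ := ih (n'.degree + (m - m').degree) (by have := he i; omega)
      (substDivMod e f n' * monomial (m - m') 1)
      ((substDivMod_isHomogeneous hf n').mul (isHomogeneous_monomial _ rfl))
    refine ⟨X i ^ e i * r, ?_, ?_⟩
    · have := (isHomogeneous_X_pow (R := K) i (e i)).mul hr
      rwa [← add_assoc, hdeg] at this
    · rw [substDivModLinear_X_pow_mul (he i), hr', substDivMod_add_single (he i), mul_assoc]
  choose! r hr hr' using hstep
  refine ⟨∑ n ∈ q.support, coeff n q • r n, ?_, ?_⟩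
  · refine IsHomogeneous.sum _ _ _ fun n hn => ?_
    rw [smul_eq_C_mul]
    exact (hr n hn).C_mul _
  · have h1 : (monomial m 1 : MvPolynomial σ K) = monomial m' 1 * monomial (m - m') 1 := by
      rw [monomial_mul, one_mul, add_tsub_cancel_of_le hm'le]
    rw [h1, ← hqm]
    conv_rhs => rw [q.as_sum]
    rw [map_sum, map_sum, Finset.sum_mul]
    refine Finset.sum_congr rfl fun n hn => ?_
    rw [map_smul, hr' n hn]
    have : monomial n (coeff n q) = coeff n q • monomial n (1 : K) := by
      rw [smul_monomial, smul_eq_mul, mul_one]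
    rw [this, map_smul, substDivModLinear_monomial, smul_mul_assoc]

theorem substDivModLinear_bijective (he : ∀ i, 0 < e i)
    (hf : ∀ i, (f i).IsHomogeneous (e i)) (hdet : substDivModDet e f ≠ 0) :
    Function.Bijective (substDivModLinear e f) := by
  have hsurj := isHomogeneous_mem_map_substDivModLinear he hf hdet
  have hinj : ∀ k, ∀ p : MvPolynomial σ K, p.IsHomogeneous k →
      substDivModLinear e f p = 0 → p = 0 := by
    intro k p hp h0
    let V := homogeneousSubmodule σ K k
    have hV : FiniteDimensional K V :=
      Module.Finite.iff_fg.mpr (homogeneousSubmodule_fg (σ := σ) (R := K) k)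
    let T : V →ₗ[K] V := (substDivModLinear e f).restrict
      (fun p hp => substDivModLinear_isHomogeneous hf hp)
    have hT : Function.Surjective T := by
      rintro ⟨p, hp⟩
      obtain ⟨q, hq, hqp⟩ := hsurj k p hp
      exact ⟨⟨q, hq⟩, Subtype.ext hqp⟩
    have hT' := LinearMap.injective_iff_surjective.mpr hT
    have : (⟨p, hp⟩ : V) = 0 := hT' (by
      rw [map_zero]
      exact Subtype.ext h0)
    exact congrArg Subtype.val this
  constructor
  · rw [injective_iff_map_eq_zero]
    intro p hp
    have hcomp : ∀ k, homogeneousComponent k p = 0 := fun k => by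
      refine hinj k _ (homogeneousComponent_isHomogeneous k p) ?_
      have h1 : homogeneousComponent k (substDivModLinear e f p) = 0 := by rw [hp, map_zero]
      rw [← sum_homogeneousComponent p, map_sum, map_sum] at h1
      have h2 : ∀ i ∈ Finset.range (p.totalDegree + 1),
          homogeneousComponent k (substDivModLinear e f (homogeneousComponent i p)) =
            if i = k then substDivModLinear e f (homogeneousComponent k p) else 0 := by
        intro i _
        rw [homogeneousComponent_of_mem
          (substDivModLinear_isHomogeneous hf (homogeneousComponent_isHomogeneous i p))]
        split_ifs with h h' h'
        · rw [h]
        · exact absurd h.symm h'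
        · exact absurd h'.symm h
        · rfl
      rw [Finset.sum_congr rfl h2, Finset.sum_ite_eq'] at h1
      split_ifs at h1 with h
      · exact h1
      · rw [homogeneousComponent_eq_zero _ _ (by simpa using h), map_zero]
    rw [← sum_homogeneousComponent p]
    exact Finset.sum_eq_zero fun k _ => hcomp k
  · intro p
    choose q _ hq using fun k => hsurj k _ (homogeneousComponent_isHomogeneous k p)
    refine ⟨∑ k ∈ Finset.range (p.totalDegree + 1), q k, ?_⟩
    rw [map_sum, Finset.sum_congr rfl fun k _ => hq k, sum_homogeneousComponent]

end Bijective

theorem isRegSeq_X_pow {σ : Type*} {i j k : σ} (hij : i ≠ j) (hik : i ≠ k) (hjk : j ≠ k)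
    (a b c : ℕ) :
    IsRegSeq (X i ^ a : MvPolynomial σ ℂ) (X j ^ b) (X k ^ c) := by
  classical
  have hone : ∀ (s : Set (σ →₀ ℕ)) (u : σ →₀ ℕ), (∀ t ∈ s, ∀ l ∈ t.support, u l = 0) →
      ∀ h : MvPolynomial σ ℂ,
      monomial u 1 * h ∈ Ideal.span ((fun t => monomial t (1 : ℂ)) '' s) →
        h ∈ Ideal.span ((fun t => monomial t (1 : ℂ)) '' s) := by
    intro s u hs h hh
    rw [mem_ideal_span_monomial_image] at hh ⊢
    intro n hn
    obtain ⟨t, ht, htn⟩ := hh (u + n) (by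
      rw [mem_support_iff, coeff_monomial_mul, one_mul]
      exact mem_support_iff.mp hn)
    refine ⟨t, ht, fun l => ?_⟩
    by_cases hl : l ∈ t.support
    · have h1 := htn l
      have h2 := hs t ht l hl
      simp only [Finsupp.add_apply, h2, zero_add] at h1
      exact h1
    · rw [Finsupp.notMem_support_iff.mp hl]
      exact Nat.zero_le _
  refine ⟨fun h hh => ?_, fun h hh => ?_, fun h hh => ?_⟩
  · exact (mul_eq_zero.mp hh).resolve_left (pow_ne_zero _ (X_ne_zero i))
  · have := hone {Finsupp.single i a} (Finsupp.single j b) (by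
      intro t ht l hl
      rw [Set.mem_singleton_iff] at ht
      subst ht
      have := Finset.mem_singleton.mp (Finsupp.support_single_subset hl)
      subst this
      exact Finsupp.single_eq_of_ne hij) h
    simpa only [Set.image_singleton, ← X_pow_eq_monomial] using this
      (by simpa only [Set.image_singleton, ← X_pow_eq_monomial] using hh)
  · have := hone {Finsupp.single i a, Finsupp.single j b} (Finsupp.single k c) (by
      intro t ht l hl
      rcases ht with rfl | ht
      · have := Finset.mem_singleton.mp (Finsupp.support_single_subset hl)
        subst this
        exact Finsupp.single_eq_of_ne hik
      · rw [Set.mem_singleton_iff] at ht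
        subst ht
        have := Finset.mem_singleton.mp (Finsupp.support_single_subset hl)
        subst this
        exact Finsupp.single_eq_of_ne hjk) h
    simpa only [Set.image_pair, ← X_pow_eq_monomial] using this
      (by simpa only [Set.image_pair, ← X_pow_eq_monomial] using hh)

theorem isRegSeq_of_substDivModDet_ne_zero {σ : Type*} [Fintype σ] {e : σ → ℕ}
    {f : σ → MvPolynomial σ ℂ} (he : ∀ i, 0 < e i) (hf : ∀ i, (f i).IsHomogeneous (e i))
    (hdet : substDivModDet e f ≠ 0) {i j k : σ} (hij : i ≠ j) (hik : i ≠ k) (hjk : j ≠ k) :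
    IsRegSeq (f i) (f j) (f k) := by
  obtain ⟨hinj, hsurj⟩ := substDivModLinear_bijective he hf hdet
  obtain ⟨h1, h2, h3⟩ := isRegSeq_X_pow hij hik hjk (e i) (e j) (e k)
  have hmul := fun i => substDivModLinear_X_pow_mul (f := f) (he i)
  simp only [Ideal.mem_span_singleton', Ideal.mem_span_pair] at h2 h3
  refine ⟨fun h hh => ?_, fun h hh => ?_, fun h hh => ?_⟩
  · obtain ⟨p, rfl⟩ := hsurj h
    rw [← hmul, map_eq_zero_iff _ hinj] at hh
    rw [h1 p hh, map_zero]
  · obtain ⟨p, rfl⟩ := hsurj h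
    rw [Ideal.mem_span_singleton'] at hh ⊢
    obtain ⟨u, hu⟩ := hh
    obtain ⟨q, rfl⟩ := hsurj u
    rw [mul_comm, ← hmul, ← hmul] at hu
    obtain ⟨r, rfl⟩ := h2 p ⟨q, by rw [mul_comm]; exact hinj hu⟩
    exact ⟨substDivModLinear e f r, by rw [mul_comm, mul_comm r, hmul]⟩
  · obtain ⟨p, rfl⟩ := hsurj h
    rw [Ideal.mem_span_pair] at hh ⊢
    obtain ⟨u, v, huv⟩ := hh
    obtain ⟨q, rfl⟩ := hsurj u
    obtain ⟨r, rfl⟩ := hsurj v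
    rw [mul_comm, ← hmul, mul_comm _ (f j), ← hmul, ← hmul, ← map_add] at huv
    obtain ⟨q', r', rfl⟩ := h3 p ⟨q, r, by rw [mul_comm, mul_comm r]; exact hinj huv⟩
    refine ⟨substDivModLinear e f q', substDivModLinear e f r', ?_⟩
    rw [map_add, mul_comm, mul_comm _ (f j), mul_comm q', mul_comm r', hmul, hmul]

theorem exists_eval_ne_zero_subset_image_of_aeval_injective {ι κ : Type*} [Finite ι] [Finite κ]
    (φ : κ → MvPolynomial ι ℂ)
    (hφ : Function.Injective (aeval φ : MvPolynomial κ ℂ →ₐ[ℂ] MvPolynomial ι ℂ))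
    {D : MvPolynomial ι ℂ} (hD : D ≠ 0) :
    ∃ P : MvPolynomial κ ℂ, P ≠ 0 ∧
      ∀ y, eval y P ≠ 0 → ∃ x, eval x D ≠ 0 ∧ ∀ k, eval x (φ k) = y k := by
  classical
  set f : MvPolynomial κ ℂ →+* MvPolynomial ι ℂ :=
    (aeval φ : MvPolynomial κ ℂ →ₐ[ℂ] MvPolynomial ι ℂ).toRingHom with hf
  have hfp : f.FinitePresentation := by
    refine RingHom.FinitePresentation.of_comp_finiteType (C : ℂ →+* MvPolynomial κ ℂ) (g := f) ?_ ?_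
    · have : f.comp C = algebraMap ℂ (MvPolynomial ι ℂ) := by
        ext x; simp [hf]
      rw [this, RingHom.finitePresentation_algebraMap]
      infer_instance
    · change (algebraMap ℂ (MvPolynomial κ ℂ)).FiniteType
      rw [RingHom.finiteType_algebraMap]
      infer_instance
  have hc := PrimeSpectrum.isConstructible_comap_image hfp
    (PrimeSpectrum.isConstructible_basicOpen (f := D))
  obtain ⟨S, hS⟩ := PrimeSpectrum.exists_constructibleSetData_iff.mpr hc
  have hbot : (⊥ : PrimeSpectrum (MvPolynomial κ ℂ)) ∈ S.toSet := by
    rw [hS]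
    refine ⟨⊥, ?_, ?_⟩
    · simpa [PrimeSpectrum.mem_basicOpen] using hD
    · ext x
      change f x = 0 ↔ x = 0
      exact map_eq_zero_iff f hφ
  simp only [PrimeSpectrum.ConstructibleSetData.toSet, Set.mem_iUnion] at hbot
  obtain ⟨T, hT, hTb, hTf⟩ := hbot
  refine ⟨T.f, fun h => hTf ?_, fun y hy => ?_⟩
  · intro x hx
    rw [Set.mem_singleton_iff] at hx
    simp [hx, h]
  let I : Ideal (MvPolynomial κ ℂ) := RingHom.ker (eval y)
  have hI : I.IsPrime := RingHom.ker_isPrime _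
  have hmem : (⟨I, hI⟩ : PrimeSpectrum (MvPolynomial κ ℂ)) ∈ S.toSet := by
    simp only [PrimeSpectrum.ConstructibleSetData.toSet, Set.mem_iUnion]
    refine ⟨T, hT, ?_, fun h => hy (h rfl)⟩
    intro z hz
    have : z = 0 := by simpa using hTb hz
    simp [this]
  rw [hS] at hmem
  obtain ⟨q, hqD, hq⟩ := hmem
  have hqI : ∀ P, f P ∈ q.asIdeal ↔ eval y P = 0 := fun P => by
    have := congrArg PrimeSpectrum.asIdeal hq
    exact (SetLike.ext_iff.mp this P)
  have hrad : D ∉ (q.asIdeal).radical := by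
    rw [q.isPrime.radical]
    exact hqD
  rw [← vanishingIdeal_zeroLocus_eq_radical (K := ℂ)] at hrad
  simp only [mem_vanishingIdeal_iff, not_forall] at hrad
  obtain ⟨x, hx, hxD⟩ := hrad
  refine ⟨x, by simpa [aeval_eq_eval] using hxD, fun k => ?_⟩
  have h1 : φ k - C (y k) ∈ q.asIdeal := by
    have := (hqI (X k - C (y k))).mpr (by simp)
    simpa [hf] using this
  have := hx _ h1
  simpa [sub_eq_zero, aeval_eq_eval] using this

theorem aeval_injective_of_bilinear_surjective {ι κ : Type*} [Fintype ι] [Fintype κ]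
    (φ : κ → MvPolynomial ι ℂ) (β : (ι → ℂ) →ₗ[ℂ] (ι → ℂ) →ₗ[ℂ] (κ → ℂ))
    (hβ : ∀ x k, eval x (φ k) = β x x k) (p : ι → ℂ)
    (hp : ∀ y, ∃ v, β p v + β v p = y) :
    Function.Injective (aeval φ : MvPolynomial κ ℂ →ₐ[ℂ] MvPolynomial ι ℂ) := by
  rw [injective_iff_map_eq_zero]
  intro Q hQ
  have hd := (β.toContinuousBilinearMap).hasStrictFDerivAt_of_bilinear
    (hasStrictFDerivAt_id p) (hasStrictFDerivAt_id p)
  have hn := hd.map_nhds_eq_of_surj (by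
    rw [LinearMap.range_eq_top]
    intro y
    obtain ⟨v, hv⟩ := hp y
    exact ⟨v, by simpa using hv⟩)
  have hev : ∀ᶠ y in nhds (β p p), eval y Q = 0 := by
    have : nhds (β p p) = Filter.map (fun x => β x x) (nhds p) := hn.symm
    rw [this, Filter.eventually_map]
    refine Filter.Eventually.of_forall fun x => ?_
    have h1 : eval x (aeval φ Q) = 0 := by rw [hQ, map_zero]
    have h2 : eval x (aeval φ Q) = eval (fun k => eval x (φ k)) Q := by
      rw [← aeval_eq_eval, ← aeval_eq_eval, ← AlgHom.comp_apply]
      congr 1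
      ext k
      simp [aeval_eq_eval]
    rw [← h1, h2]
    congr 2
    exact funext fun k => (hβ x k).symm
  rw [Metric.eventually_nhds_iff] at hev
  obtain ⟨ε, hε, hb⟩ := hev
  refine funext_set (fun k => Metric.ball (β p p k) ε) (fun k => ?_) fun y hy => ?_
  · exact (infinite_of_mem_nhds _ (Metric.ball_mem_nhds _ hε))
  · rw [map_zero]
    refine hb ?_
    rw [dist_pi_lt_iff hε]
    exact fun k => hy k (Set.mem_univ _)

/-- `VanishesToOrder S P u`: the Taylor expansion of `S` around `P` starts in degree `u`. -/
def VanishesToOrder {σ : Type*} (S : MvPolynomial σ ℂ) (P : σ → ℂ) (u : ℕ) : Prop :=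
  (Polynomial.X : Polynomial (MvPolynomial σ ℂ)) ^ u ∣
    aeval (fun i => Polynomial.C (C (P i)) + Polynomial.X * Polynomial.C (X i)) S

theorem VanishesToOrder.of_X_mul_of_ne_zero {σ : Type*} {S : MvPolynomial σ ℂ} {P : σ → ℂ}
    {u : ℕ} {j : σ} (h : VanishesToOrder (X j * S) P u) (hj : P j ≠ 0) :
    VanishesToOrder S P u := by
  unfold VanishesToOrder at h ⊢
  rw [map_mul, aeval_X] at h
  refine Polynomial.prime_X.pow_dvd_of_dvd_mul_left _ ?_ h
  rw [Polynomial.X_dvd_iff]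
  simpa using hj

theorem VanishesToOrder.of_X_mul_of_eq_zero {σ : Type*} {S : MvPolynomial σ ℂ} {P : σ → ℂ}
    {u : ℕ} {j : σ} (h : VanishesToOrder (X j * S) P u) (hj : P j = 0) :
    VanishesToOrder S P (u - 1) := by
  unfold VanishesToOrder at h ⊢
  rw [map_mul, aeval_X, hj, map_zero, map_zero, zero_add] at h
  cases u with
  | zero => simp
  | succ n =>
    rw [pow_succ', mul_assoc, mul_dvd_mul_iff_left Polynomial.X_ne_zero] at h
    refine Polynomial.prime_X.pow_dvd_of_dvd_mul_left _ ?_ h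
    rw [Polynomial.X_dvd_iff]
    simp

theorem VanishesToOrder.pow_dvd_aeval {σ : Type*} {S : MvPolynomial σ ℂ} {P : σ → ℂ}
    {u D : ℕ} (h : VanishesToOrder S P u) (hS : S.IsHomogeneous D) (γ : σ → Polynomial ℂ)
    {s κ : ℂ} (hκ : κ ≠ 0) (hγ : ∀ i, (γ i).eval s = κ * P i) :
    (Polynomial.X - Polynomial.C s) ^ u ∣ aeval γ S := by
  have hw : ∀ i, ∃ w : Polynomial ℂ, γ i = Polynomial.C κ *
      (Polynomial.C (P i) + (Polynomial.X - Polynomial.C s) * w) := by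
    intro i
    have h1 : Polynomial.X - Polynomial.C s ∣ γ i - Polynomial.C (κ * P i) := by
      rw [Polynomial.dvd_iff_isRoot]
      simp [hγ i]
    obtain ⟨v, hv⟩ := h1
    refine ⟨Polynomial.C κ⁻¹ * v, ?_⟩
    have h2 : (Polynomial.C κ * Polynomial.C κ⁻¹ : Polynomial ℂ) = 1 := by
      rw [← Polynomial.C_mul, mul_inv_cancel₀ hκ, Polynomial.C_1]
    rw [Polynomial.C_mul] at hv
    linear_combination hv - (Polynomial.X - Polynomial.C s) * v * h2
  choose w hw using hw
  have h1 : aeval γ S = Polynomial.C κ ^ D *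
      aeval (fun i => Polynomial.C (P i) + (Polynomial.X - Polynomial.C s) * w i) S := by
    rw [show γ = _ from funext hw, aeval_def, aeval_def, eval₂_eq, eval₂_eq, Finset.mul_sum]
    refine Finset.sum_congr rfl fun m hm => ?_
    have hd : m.degree = D := by
      rw [Finsupp.degree_eq_weight_one]
      exact hS (mem_support_iff.mp hm)
    simp only [mul_pow, Finset.prod_mul_distrib, Finset.prod_pow_eq_pow_sum]
    rw [show ∑ i ∈ m.support, m i = D from hd]
    ring
  have h2 := map_dvd (Polynomial.eval₂RingHom
    (aeval w : MvPolynomial σ ℂ →ₐ[ℂ] Polynomial ℂ).toRingHom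
    (Polynomial.X - Polynomial.C s)) h
  rw [h1]
  refine Dvd.dvd.mul_left ?_ _
  convert h2 using 1
  · simp
  · have hcomp : (Polynomial.eval₂RingHom
        (aeval w : MvPolynomial σ ℂ →ₐ[ℂ] Polynomial ℂ).toRingHom
        (Polynomial.X - Polynomial.C s)).comp
          (aeval (fun i => Polynomial.C (C (P i)) + Polynomial.X * Polynomial.C (X i)) :
            MvPolynomial σ ℂ →ₐ[ℂ] Polynomial (MvPolynomial σ ℂ)).toRingHom =
        (aeval (fun i => Polynomial.C (P i) + (Polynomial.X - Polynomial.C s) * w i) :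
          MvPolynomial σ ℂ →ₐ[ℂ] Polynomial ℂ).toRingHom := by
      ext i
      · simp
      · simp [mul_comm (w i)]
    exact (RingHom.congr_fun hcomp S).symm

theorem eq_zero_of_vanishesToOrder_curve {σ : Type*} {S : MvPolynomial σ ℂ} {D : ℕ}
    (hS : S.IsHomogeneous D) (γ : σ → Polynomial ℂ) {n : ℕ} (hdeg : ∀ i, (γ i).natDegree ≤ n)
    {P : Fin 4 → σ → ℂ} {u : Fin 4 → ℕ} (hP : ∀ q, VanishesToOrder S (P q) (u q))
    {s κ : Fin 4 → ℂ} (hs : Function.Injective s) (hκ : ∀ q, κ q ≠ 0)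
    (hγ : ∀ q i, (γ i).eval (s q) = κ q * P q i) (hu : D * n < ∑ q, u q) :
    aeval γ S = 0 := by
  have h1 : ∏ q, (Polynomial.X - Polynomial.C (s q)) ^ u q ∣ aeval γ S :=
    Fintype.prod_dvd_of_coprime
      (fun i j hij => (Polynomial.pairwise_coprime_X_sub_C hs hij).pow)
      fun q => (hP q).pow_dvd_aeval hS γ (hκ q) (hγ q)
  refine Polynomial.eq_zero_of_dvd_of_natDegree_lt h1 ?_
  have h2 : (aeval γ S).natDegree ≤ D * n := aeval_natDegree_le S hS.totalDegree_le γ hdeg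
  rw [Polynomial.natDegree_prod _ _ fun q _ => pow_ne_zero _ (Polynomial.X_sub_C_ne_zero _)]
  simpa using h2.trans_lt hu

theorem injective_vecCons_div_sub_one {x y z : ℂ} (hx : x ≠ 0) (hy : y ≠ 0) (hz : z ≠ 0)
    (hx' : x - 1 ≠ 0) (hy' : y - 1 ≠ 0) (hz' : z - 1 ≠ 0) (hxy : x ≠ y) (hxz : x ≠ z)
    (hyz : y ≠ z) :
    Function.Injective ![x / (x - 1), y / (y - 1), z / (z - 1), 0] := by
  have hdiv : ∀ x y : ℂ, x - 1 ≠ 0 → y - 1 ≠ 0 → x ≠ y → x / (x - 1) ≠ y / (y - 1) := by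
    intro x y hx hy hxy h
    rw [div_eq_div_iff hx hy] at h
    exact hxy (by linear_combination -h)
  have h1 := hdiv x y hx' hy' hxy
  have h2 := hdiv x z hx' hz' hxz
  have h3 := hdiv y z hy' hz' hyz
  have h4 := div_ne_zero hx hx'
  have h5 := div_ne_zero hy hy'
  have h6 := div_ne_zero hz hz'
  generalize x / (x - 1) = p at *
  generalize y / (y - 1) = q at *
  generalize z / (z - 1) = r at *
  intro i j hij
  fin_cases i <;> fin_cases j <;> first | rfl | exact absurd hij ‹_› | exact absurd hij.symm ‹_›

theorem eval_plane_eq_zero_of_vanishesToOrder {σ : Type*} {S : MvPolynomial σ ℂ} {D : ℕ}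
    (hS : S.IsHomogeneous D) {u : Fin 4 → ℕ} {P : Fin 4 → σ → ℂ}
    (hP : ∀ q, VanishesToOrder S (P q) (u q)) (hP3 : P 3 = P 0 + P 1 + P 2)
    (hu : D * 2 < ∑ q, u q) (t : Fin 3 → ℂ) :
    eval (fun i => t 0 * P 0 i + t 1 * P 1 i + t 2 * P 2 i) S = 0 := by
  have key : ∀ t : Fin 3 → ℂ, t 0 ≠ 0 → t 1 ≠ 0 → t 2 ≠ 0 → t 0 ≠ 1 → t 1 ≠ 1 → t 2 ≠ 1 →
      t 0 ≠ t 1 → t 0 ≠ t 2 → t 1 ≠ t 2 →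
      eval (fun i => t 0 * P 0 i + t 1 * P 1 i + t 2 * P 2 i) S = 0 := by
    intro t h0 h1 h2 h0' h1' h2' h01 h02 h12
    have e0 : t 0 - 1 ≠ 0 := sub_ne_zero.mpr h0'
    have e1 : t 1 - 1 ≠ 0 := sub_ne_zero.mpr h1'
    have e2 : t 2 - 1 ≠ 0 := sub_ne_zero.mpr h2'
    have e01 := sub_ne_zero.mpr h01
    have e02 := sub_ne_zero.mpr h02
    have e12 := sub_ne_zero.mpr h12
    have e10 := sub_ne_zero.mpr h01.symm
    have e20 := sub_ne_zero.mpr h02.symm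
    have e21 := sub_ne_zero.mpr h12.symm
    let l : Fin 3 → Polynomial ℂ := fun i =>
      Polynomial.C (t i) + Polynomial.C (1 - t i) * Polynomial.X
    let γ : σ → Polynomial ℂ := fun i => Polynomial.C (t 0 * P 0 i) * (l 1 * l 2) +
      Polynomial.C (t 1 * P 1 i) * (l 0 * l 2) + Polynomial.C (t 2 * P 2 i) * (l 0 * l 1)
    have hdeg : ∀ i, (γ i).natDegree ≤ 2 := by
      intro i
      simp only [γ, l]
      compute_degree
    have hs := injective_vecCons_div_sub_one h0 h1 h2 e0 e1 e2 h01 h02 h12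
    have h := eq_zero_of_vanishesToOrder_curve hS γ hdeg hP hs
      (κ := ![t 0 * ((t 0 - t 1) * (t 0 - t 2)) / (t 0 - 1) ^ 2,
        t 1 * ((t 1 - t 0) * (t 1 - t 2)) / (t 1 - 1) ^ 2,
        t 2 * ((t 2 - t 0) * (t 2 - t 1)) / (t 2 - 1) ^ 2, t 0 * t 1 * t 2])
      (by intro q; fin_cases q <;> simp [h0, h1, h2, e0, e1, e2, e01, e02, e12, e10, e20, e21])
      (by
        intro q i
        fin_cases q <;> simp [γ, l, hP3] <;> field_simp <;> ring)
      hu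
    have h' : eval (fun i => (γ i).eval 1) S = (aeval γ S).eval 1 := by
      have : ((Polynomial.evalRingHom 1).comp
          (aeval γ : MvPolynomial σ ℂ →ₐ[ℂ] Polynomial ℂ).toRingHom) =
          eval (fun i => (γ i).eval 1) := by
        ext i <;> simp
      exact (RingHom.congr_fun this S).symm
    rw [h, Polynomial.eval_zero] at h'
    rw [← h']
    congr 2
    funext i
    simp [γ, l]
  set g : MvPolynomial (Fin 3) ℂ :=
    aeval (fun i => X 0 * C (P 0 i) + X 1 * C (P 1 i) + X 2 * C (P 2 i)) S with hg
  have hgt : ∀ t, eval t g = eval (fun i => t 0 * P 0 i + t 1 * P 1 i + t 2 * P 2 i) S := by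
    intro t
    have : ((eval t).comp (aeval (fun i => X 0 * C (P 0 i) + X 1 * C (P 1 i) + X 2 * C (P 2 i)) :
        MvPolynomial σ ℂ →ₐ[ℂ] MvPolynomial (Fin 3) ℂ).toRingHom) =
        eval (fun i => t 0 * P 0 i + t 1 * P 1 i + t 2 * P 2 i) := by
      ext i <;> simp
    exact RingHom.congr_fun this S
  have hbad : (X 0 * X 1 * X 2 * (X 0 - 1) * (X 1 - 1) * (X 2 - 1) * (X 0 - X 1) * (X 0 - X 2) *
      (X 1 - X 2)) * g = 0 := by
    refine MvPolynomial.funext fun t => ?_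
    by_contra h
    simp only [map_mul, map_sub, eval_X, map_one, map_zero, mul_eq_zero, not_or, sub_eq_zero] at h
    obtain ⟨⟨⟨⟨⟨⟨⟨⟨⟨h0, h1⟩, h2⟩, h0'⟩, h1'⟩, h2'⟩, h01⟩, h02⟩, h12⟩, hh⟩ := h
    exact hh ((hgt t).trans (key t h0 h1 h2 h0' h1' h2' h01 h02 h12))
  have hne : (X 0 * X 1 * X 2 * (X 0 - 1) * (X 1 - 1) * (X 2 - 1) * (X 0 - X 1) * (X 0 - X 2) *
      (X 1 - X 2) : MvPolynomial (Fin 3) ℂ) ≠ 0 := by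
    intro h
    have := congrArg (eval ![2, 3, 4]) h
    norm_num [Matrix.cons_val_two] at this
  rw [← hgt, (mul_eq_zero.mp hbad).resolve_left hne, map_zero]

/-- Twelve points of `ℙ³`: for each of the three coordinate planes `{x_j = 0}`, `j < 3`, the
points `A`, `B`, `C` and `A + B + C` in general position in that plane. -/
def planePoint (j : Fin 3) (q : Fin 4) : Fin 4 → ℂ :=
  j.castSucc.insertNth (α := fun _ => ℂ) 0 ((![![1, 1, 0], ![1, 1, 1], ![1, 2, 0], ![3, 4, 1]] :
    Fin 4 → Fin 3 → ℂ) q)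

theorem planePoint_castSucc_self (j : Fin 3) (q : Fin 4) : planePoint j q j.castSucc = 0 := by
  simp [planePoint]

theorem planePoint_castSucc_ne_zero {j k : Fin 3} (h : k ≠ j) (q : Fin 4) :
    planePoint j q k.castSucc ≠ 0 := by
  obtain ⟨l, hl, hl2⟩ : ∃ l : Fin 3, k.castSucc = j.castSucc.succAbove l ∧ l ≠ 2 := by
    revert j k
    decide
  rw [hl, planePoint, Fin.insertNth_apply_succAbove]
  fin_cases l <;> fin_cases q <;> simp at hl2 ⊢

theorem planePoint_three (j : Fin 3) :
    planePoint j 3 = planePoint j 0 + planePoint j 1 + planePoint j 2 := by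
  funext i
  refine Fin.succAboveCases j.castSucc ?_ (fun k => ?_) i
  · simp [planePoint]
  · simp only [planePoint, Fin.insertNth_apply_succAbove, Pi.add_apply]
    fin_cases k <;> simp [Matrix.cons_val] <;> norm_num

theorem exists_eq_combination_planePoint {j : Fin 3} {y : Fin 4 → ℂ} (hy : y j.castSucc = 0) :
    ∃ t : Fin 3 → ℂ, y = fun i => t 0 * planePoint j 0 i + t 1 * planePoint j 1 i +
      t 2 * planePoint j 2 i := by
  set z : Fin 3 → ℂ := fun i => y (j.castSucc.succAbove i) with hz
  refine ⟨![z 0 - z 2 - (z 1 - z 0), z 2, z 1 - z 0], ?_⟩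
  funext i
  refine Fin.succAboveCases j.castSucc ?_ (fun k => ?_) i
  · simp [planePoint, hy]
  · change z k = _
    simp only [planePoint, Fin.insertNth_apply_succAbove]
    fin_cases k <;> simp <;> ring

theorem X_dvd_of_eval_eq_zero {σ : Type*} {S : MvPolynomial σ ℂ} {j : σ}
    (h : ∀ y : σ → ℂ, y j = 0 → eval y S = 0) : X j ∣ S := by
  classical
  set r : MvPolynomial σ ℂ →ₐ[ℂ] MvPolynomial σ ℂ := aeval (Function.update X j 0) with hr
  have h0 : r S = 0 := by
    refine MvPolynomial.funext fun y => ?_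
    have hc : (eval y).comp r.toRingHom = eval (Function.update y j 0) := by
      ext i
      · simp
      · by_cases hi : i = j
        · subst hi; simp [hr]
        · simp [hr, hi]
    rw [map_zero, ← h (Function.update y j 0) (by simp)]
    exact RingHom.congr_fun hc S
  have h1 : (Ideal.Quotient.mkₐ ℂ (Ideal.span {X j})).comp r =
      Ideal.Quotient.mkₐ ℂ (Ideal.span {(X j : MvPolynomial σ ℂ)}) := by
    ext i
    by_cases hi : i = j
    · subst hi
      simp [hr]
    · simp [hr, hi]
  have h2 := AlgHom.congr_fun h1 S
  rw [AlgHom.comp_apply, h0, map_zero, eq_comm] at h2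
  exact Ideal.mem_span_singleton.mp (Ideal.Quotient.eq_zero_iff_mem.mp h2)

theorem exists_eq_X_mul_of_vanishesToOrder {S : MvPolynomial (Fin 4) ℂ} {D : ℕ}
    (hS : S.IsHomogeneous D) {u : Fin 3 → Fin 4 → ℕ}
    (hu : ∀ j q, VanishesToOrder S (planePoint j q) (u j q)) {j : Fin 3}
    (hj : D * 2 < ∑ q, u j q) :
    ∃ S' : MvPolynomial (Fin 4) ℂ, S = X j.castSucc * S' ∧ S'.IsHomogeneous (D - 1) ∧
      (D = 0 → S' = 0) ∧
      ∀ k q, VanishesToOrder S' (planePoint k q) (if k = j then u k q - 1 else u k q) := by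
  obtain ⟨S', rfl⟩ := X_dvd_of_eval_eq_zero (S := S) (j := j.castSucc) fun y hy => by
    obtain ⟨t, ht⟩ := exists_eq_combination_planePoint hy
    rw [ht]
    exact eval_plane_eq_zero_of_vanishesToOrder hS (hu j) (planePoint_three j) hj t
  have hdeg : ∀ m, coeff m S' ≠ 0 → Finsupp.weight 1 m + 1 = D := by
    intro m hm
    rw [← hS (d := m + Finsupp.single j.castSucc 1) (by simpa [mul_comm] using hm), map_add,
      Finsupp.weight_single]
    simp
  refine ⟨S', rfl, fun m hm => ?_, ?_, fun k q => ?_⟩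
  · have := hdeg m hm
    omega
  · rintro rfl
    by_contra h
    obtain ⟨m, hm⟩ := MvPolynomial.ne_zero_iff.mp h
    exact absurd (hdeg m hm) (Nat.succ_ne_zero _)
  · split_ifs with hk
    · subst hk
      exact (hu k q).of_X_mul_of_eq_zero (planePoint_castSucc_self k q)
    · exact (hu k q).of_X_mul_of_ne_zero (planePoint_castSucc_ne_zero (Ne.symm hk) q)

theorem eq_zero_of_vanishesToOrder {S : MvPolynomial (Fin 4) ℂ} {D : ℕ}
    (hS : S.IsHomogeneous D) {u : Fin 3 → Fin 4 → ℕ}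
    (hu : ∀ j q, VanishesToOrder S (planePoint j q) (u j q))
    (hD : ∀ j, D * 2 < ∑ q, u j q) : S = 0 := by
  induction D using Nat.strong_induction_on generalizing S u with
  | _ D ih =>
    obtain ⟨S₁, rfl, hS₁, h0, hu₁⟩ := exists_eq_X_mul_of_vanishesToOrder hS hu (hD 0)
    rcases Nat.eq_zero_or_pos D with hD0 | hD0
    · rw [h0 hD0, mul_zero]
    obtain ⟨S₂, rfl, hS₂, h1, hu₂⟩ := exists_eq_X_mul_of_vanishesToOrder hS₁ hu₁ (j := 1) (by
      have := hD 1; simp; omega)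
    rcases Nat.eq_zero_or_pos (D - 1) with hD1 | hD1
    · rw [h1 hD1, mul_zero, mul_zero]
    obtain ⟨S₃, rfl, hS₃, h2, hu₃⟩ := exists_eq_X_mul_of_vanishesToOrder hS₂ hu₂ (j := 2) (by
      have := hD 2; simp; omega)
    rcases Nat.eq_zero_or_pos (D - 1 - 1) with hD2 | hD2
    · rw [h2 hD2, mul_zero, mul_zero, mul_zero]
    rw [ih (D - 1 - 1 - 1) (by omega) hS₃ hu₃ (fun j => ?_), mul_zero, mul_zero, mul_zero]
    have := hD j
    fin_cases j <;> simp [Fin.sum_univ_four] at this ⊢ <;> omega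

/-- The `B`-linear extension to polynomials over `B` of a `ℂ`-linear functional on polynomials. -/
noncomputable def extendFunctional {σ : Type*} (B : Type*) [CommRing B] [Algebra ℂ B]
    (l : MvPolynomial σ ℂ →ₗ[ℂ] ℂ) : MvPolynomial σ B →ₗ[B] B :=
  (basisMonomials σ B).constr B fun m => algebraMap ℂ B (l (monomial m 1))

section

variable {σ B B' : Type*} [CommRing B] [Algebra ℂ B] [CommRing B'] [Algebra ℂ B']
  (l : MvPolynomial σ ℂ →ₗ[ℂ] ℂ)

theorem extendFunctional_monomial (m : σ →₀ ℕ) (b : B) :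
    extendFunctional B l (monomial m b) = b * algebraMap ℂ B (l (monomial m 1)) := by
  have h : (monomial m b : MvPolynomial σ B) = b • basisMonomials σ B m := by
    simp [smul_monomial]
  rw [h, map_smul, extendFunctional, Module.Basis.constr_basis, smul_eq_mul]

theorem extendFunctional_C_mul (b : B) (G : MvPolynomial σ B) :
    extendFunctional B l (C b * G) = b * extendFunctional B l G := by
  rw [← smul_eq_C_mul, map_smul, smul_eq_mul]

theorem extendFunctional_map (φ : B →ₐ[ℂ] B') (G : MvPolynomial σ B) :
    extendFunctional B' l (map (φ : B →+* B') G) = φ (extendFunctional B l G) := by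
  induction G using MvPolynomial.induction_on' with
  | monomial m b => simp [map_monomial, extendFunctional_monomial]
  | add p q hp hq => simp only [map_add, hp, hq]

theorem extendFunctional_map_algebraMap (g : MvPolynomial σ ℂ) :
    extendFunctional B l (map (algebraMap ℂ B) g) = algebraMap ℂ B (l g) := by
  induction g using MvPolynomial.induction_on' with
  | monomial m b =>
    have h : (monomial m b : MvPolynomial σ ℂ) = b • monomial m 1 := by simp [smul_monomial]
    rw [map_monomial, extendFunctional_monomial, h, map_smul, smul_eq_mul, map_mul]
  | add p q hp hq => simp only [map_add, hp, hq]

theorem extendFunctional_map_mul_eq_zero {g : MvPolynomial σ ℂ} (hg : ∀ h, l (g * h) = 0)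
    (G : MvPolynomial σ B) : extendFunctional B l (map (algebraMap ℂ B) g * G) = 0 := by
  induction G using MvPolynomial.induction_on' with
  | monomial m b =>
    have h : map (algebraMap ℂ B) g * monomial m b =
        C b * map (algebraMap ℂ B) (g * monomial m 1) := by
      rw [map_mul, map_monomial, map_one, mul_left_comm, C_mul_monomial, mul_one]
    rw [h, extendFunctional_C_mul, extendFunctional_map_algebraMap, hg, map_zero, mul_zero]
  | add p q hp hq => rw [mul_add, map_add, hp, hq, add_zero]

end

section

variable {σ : Type*} [Fintype σ] (l : MvPolynomial σ ℂ →ₗ[ℂ] ℂ)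

/-- The inverse system polynomial of degree `d` of a functional `l`: up to multinomial
coefficients, the coefficients are the values of `l` on the monomials of degree `d`. -/
noncomputable def inverseSystem (d : ℕ) : MvPolynomial σ ℂ :=
  extendFunctional (MvPolynomial σ ℂ) l ((∑ i, C (X i) * X i) ^ d)

theorem coeff_inverseSystem (d : ℕ) (t : σ →₀ ℕ) :
    coeff t (inverseSystem l d) =
      if t.degree = d then t.multinomial * l (monomial t 1) else 0 := by
  classical
  set G : MvPolynomial σ (MvPolynomial σ ℂ) := (∑ i, C (X i) * X i) ^ d with hG
  have hco : ∀ s, coeff s G = if s.degree = d then monomial s (s.multinomial : ℂ) else 0 := by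
    intro s
    have := coeff_linearCombination_X_pow_of_fintype (R := MvPolynomial σ ℂ) X s d
    simp only [smul_eq_C_mul] at this
    rw [hG, this]
    change (if s.degree = d then _ else _) = _
    refine if_congr Iff.rfl ?_ rfl
    rw [monomial_eq]
    simp
  have hsum : inverseSystem l d =
      ∑ s ∈ G.support, coeff s G * C (l (monomial s 1)) := by
    rw [inverseSystem, ← hG]
    conv_lhs => rw [G.as_sum]
    rw [map_sum]
    exact Finset.sum_congr rfl fun s _ => extendFunctional_monomial l s _
  rw [hsum, coeff_sum, Finset.sum_eq_single t]
  · rw [mul_comm, coeff_C_mul, hco]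
    split_ifs <;> simp [mul_comm]
  · intro s _ hst
    rw [mul_comm, coeff_C_mul, hco]
    split_ifs <;> simp [hst]
  · intro ht
    rw [notMem_support_iff.mp ht, zero_mul, coeff_zero]

theorem isHomogeneous_inverseSystem (d : ℕ) : (inverseSystem l d).IsHomogeneous d := by
  intro t ht
  rw [coeff_inverseSystem] at ht
  by_contra h
  refine ht (if_neg ?_)
  rwa [Finsupp.degree_eq_weight_one]

theorem eq_zero_of_inverseSystem_eq_zero {d : ℕ} (h : inverseSystem l d = 0)
    {F : MvPolynomial σ ℂ} (hF : F.IsHomogeneous d) : l F = 0 := by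
  rw [F.as_sum, map_sum]
  refine Finset.sum_eq_zero fun m hm => ?_
  have hd : m.degree = d := by
    rw [Finsupp.degree_eq_weight_one]
    exact hF (mem_support_iff.mp hm)
  have h1 : (monomial m (coeff m F) : MvPolynomial σ ℂ) = coeff m F • monomial m 1 := by
    simp [smul_monomial]
  have h2 := coeff_inverseSystem l d m
  have h3 : (m.multinomial : ℂ) ≠ 0 := by
    rw [Finsupp.multinomial_eq]
    exact_mod_cast (Nat.multinomial_pos _ _).ne'
  rw [h, coeff_zero, if_pos hd, eq_comm, mul_eq_zero] at h2
  rw [h1, map_smul, h2.resolve_left h3, smul_zero]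

theorem vanishesToOrder_inverseSystem {P : σ → ℂ} {p d : ℕ} (hp : p ≤ d)
    (hl : ∀ h, l ((∑ i, C (P i) * X i) ^ p * h) = 0) :
    VanishesToOrder (inverseSystem l d) P (d + 1 - p) := by
  unfold VanishesToOrder inverseSystem
  set φ : MvPolynomial σ ℂ →ₐ[ℂ] Polynomial (MvPolynomial σ ℂ) :=
    aeval (fun i => Polynomial.C (C (P i)) + Polynomial.X * Polynomial.C (X i)) with hφ
  set L : MvPolynomial σ ℂ := ∑ i, C (P i) * X i with hL
  have h1 : map (φ : MvPolynomial σ ℂ →+* Polynomial (MvPolynomial σ ℂ))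
      (∑ i, C (X i) * X i) = map (algebraMap ℂ (Polynomial (MvPolynomial σ ℂ))) L +
        C Polynomial.X * ∑ i, C (Polynomial.C (X i)) * X i := by
    simp only [hL, map_sum, map_mul, map_C, map_X, Finset.mul_sum, ← Finset.sum_add_distrib]
    refine Finset.sum_congr rfl fun i _ => ?_
    simp [hφ]
    ring
  rw [← extendFunctional_map, map_pow, h1, add_pow, map_sum]
  refine Finset.dvd_sum fun m hm => ?_
  rcases le_or_gt p m with hpm | hpm
  · obtain ⟨k, rfl⟩ := Nat.exists_eq_add_of_le hpm
    rw [pow_add, mul_assoc, mul_assoc, ← map_pow,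
      extendFunctional_map_mul_eq_zero l hl]
    exact dvd_zero _
  · rw [mul_pow, ← C_pow, mul_left_comm, mul_assoc, extendFunctional_C_mul]
    exact Dvd.dvd.mul_right (pow_dvd_pow _ (by omega)) _

end

theorem mem_span_range_pow_of_isHomogeneous {d : ℕ} {p : Fin 3 → Fin 4 → ℕ}
    (hp : ∀ j q, p j q ≤ d) (hsum : ∀ j, d * 2 < ∑ q, (d + 1 - p j q))
    {F : MvPolynomial (Fin 4) ℂ} (hF : F.IsHomogeneous d) :
    F ∈ Ideal.span (Set.range fun x : Fin 3 × Fin 4 =>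
      (∑ i, C (planePoint x.1 x.2 i) * X i : MvPolynomial (Fin 4) ℂ) ^ p x.1 x.2) := by
  set I := Ideal.span (Set.range fun x : Fin 3 × Fin 4 =>
      (∑ i, C (planePoint x.1 x.2 i) * X i : MvPolynomial (Fin 4) ℂ) ^ p x.1 x.2) with hI
  by_contra hFI
  obtain ⟨l, hl, hker⟩ := Submodule.exists_le_ker_of_notMem (p := I.restrictScalars ℂ) hFI
  refine hl (eq_zero_of_inverseSystem_eq_zero l (d := d) ?_ hF)
  refine eq_zero_of_vanishesToOrder (isHomogeneous_inverseSystem l d)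
    (u := fun j q => d + 1 - p j q) (fun j q => ?_) hsum
  refine vanishesToOrder_inverseSystem l (hp j q) fun h => hker ?_
  exact I.mul_mem_right _ (Ideal.subset_span ⟨(j, q), rfl⟩)

theorem homogeneousComponent_mul_of_isHomogeneous {σ R : Type*} [CommRing R]
    (c : MvPolynomial σ R) {g : MvPolynomial σ R} {d e : ℕ} (hg : g.IsHomogeneous e)
    (he : e ≤ d) : homogeneousComponent d (c * g) = homogeneousComponent (d - e) c * g := by
  conv_lhs => rw [← sum_homogeneousComponent c, Finset.sum_mul, map_sum]
  have h : ∀ i, homogeneousComponent d (homogeneousComponent i c * g) =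
      if i = d - e then homogeneousComponent i c * g else 0 := by
    intro i
    rw [homogeneousComponent_of_mem ((homogeneousComponent_isHomogeneous i c).mul hg)]
    exact if_congr (by omega) rfl rfl
  simp only [h, Finset.sum_ite_eq']
  split_ifs with hi
  · rfl
  · rw [homogeneousComponent_eq_zero _ _ (by rw [Finset.mem_range] at hi; omega), zero_mul]

theorem exists_eq_sum_mul_of_mem_span_range {σ R α : Type*} [CommRing R] [Fintype α]
    {g : α → MvPolynomial σ R} {e : α → ℕ} (hg : ∀ x, (g x).IsHomogeneous (e x)) {d : ℕ}
    (he : ∀ x, e x ≤ d) {F : MvPolynomial σ R} (hF : F.IsHomogeneous d)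
    (h : F ∈ Ideal.span (Set.range g)) :
    ∃ c : α → MvPolynomial σ R, (∀ x, (c x).IsHomogeneous (d - e x)) ∧ F = ∑ x, c x * g x := by
  obtain ⟨c, hc⟩ := Ideal.mem_span_range_iff_exists_fun.mp h
  refine ⟨fun x => homogeneousComponent (d - e x) (c x),
    fun x => homogeneousComponent_isHomogeneous _ _, ?_⟩
  have h1 : homogeneousComponent d F = F := by
    rw [homogeneousComponent_of_mem hF, if_pos rfl]
  rw [← h1, ← hc, map_sum]
  refine Finset.sum_congr rfl fun x _ => ?_
  exact homogeneousComponent_mul_of_isHomogeneous _ (hg x) (he x)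

/-- The degrees of the forms in `∑ f * f'`, where `f` has degree `δ i` and its partner `f'` has
degree `d - δ i`. -/
def factorDegree (d : ℕ) (δ : Fin 3 → ℕ) (j : (Fin 2 × Fin 3) × Bool) : ℕ :=
  bif j.2 then d - δ j.1.2 else δ j.1.2

theorem exists_forms_generating_degree {d : ℕ} {δ : Fin 3 → ℕ} (hδ : ∀ i, δ i ≤ d) :
    ∃ L : (Fin 2 × Fin 3) × Bool → MvPolynomial (Fin 4) ℂ,
      (∀ j, (L j).IsHomogeneous (factorDegree d δ j)) ∧
      ∀ F : MvPolynomial (Fin 4) ℂ, F.IsHomogeneous d →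
        ∃ c : (Fin 2 × Fin 3) × Bool → MvPolynomial (Fin 4) ℂ,
          (∀ j, (c j).IsHomogeneous (d - factorDegree d δ j)) ∧ F = ∑ j, c j * L j := by
  let e : Fin 2 × Bool ≃ Fin 4 :=
    ((Equiv.refl _).prodCongr finTwoEquiv.symm).trans finProdFinEquiv
  let E : (Fin 2 × Fin 3) × Bool ≃ Fin 3 × Fin 4 :=
    (((Equiv.prodComm _ _).prodCongr (Equiv.refl _)).trans (Equiv.prodAssoc _ _ _)).trans
      ((Equiv.refl _).prodCongr e)
  let p : Fin 3 → Fin 4 → ℕ := fun i q => factorDegree d δ (E.symm (i, q))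
  let g : Fin 3 × Fin 4 → MvPolynomial (Fin 4) ℂ := fun x =>
    (∑ i, C (planePoint x.1 x.2 i) * X i) ^ p x.1 x.2
  have hg : ∀ x, (g x).IsHomogeneous (p x.1 x.2) := by
    intro x
    have h : (∑ i, C (planePoint x.1 x.2 i) * X i : MvPolynomial (Fin 4) ℂ).IsHomogeneous 1 :=
      IsHomogeneous.sum _ _ _ fun i _ => isHomogeneous_C_mul_X _ _
    simpa using h.pow (p x.1 x.2)
  have hp : ∀ i q, p i q ≤ d := by
    intro i q
    simp only [p, factorDegree]
    cases (E.symm (i, q)).2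
    · exact hδ _
    · exact Nat.sub_le _ _
  have hsum : ∀ i, d * 2 < ∑ q, (d + 1 - p i q) := by
    intro i
    rw [← e.sum_comp, Fintype.sum_prod_type]
    have h : ∀ t s, p i (e (t, s)) = factorDegree d δ ((t, i), s) := by
      intro t s
      exact congrArg (factorDegree d δ) (E.symm_apply_apply ((t, i), s))
    have := hδ i
    simp only [h, factorDegree, Fintype.sum_bool, Fin.sum_univ_two, cond_true, cond_false]
    omega
  refine ⟨fun j => g (E j), fun j => ?_, fun F hF => ?_⟩
  · have h := hg (E j)
    simpa only [p, Prod.mk.eta, E.symm_apply_apply] using h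
  · obtain ⟨c, hc, h⟩ := exists_eq_sum_mul_of_mem_span_range (e := fun x => p x.1 x.2) hg
      (fun x => hp _ _) hF (mem_span_range_pow_of_isHomogeneous hp hsum hF)
    refine ⟨fun j => c (E j), fun j => ?_, ?_⟩
    · have h := hc (E j)
      simpa only [p, Prod.mk.eta, E.symm_apply_apply] using h
    · rw [h, ← E.sum_comp]

theorem eq_of_isHomogeneous_of_coeff_eq {σ B : Type*} [CommRing B] {k : ℕ}
    {F G : MvPolynomial σ B} (hF : F.IsHomogeneous k) (hG : G.IsHomogeneous k)
    (h : ∀ m : {m : σ →₀ ℕ // m.degree = k}, coeff m.1 F = coeff m.1 G) : F = G := by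
  ext m
  by_cases hm : m.degree = k
  · exact h ⟨m, hm⟩
  · rw [Finsupp.degree_eq_weight_one] at hm
    rw [not_not.mp (mt (@hF m) hm), not_not.mp (mt (@hG m) hm)]

/-- The form of degree `k` with given coefficients. -/
noncomputable def formOfCoeffs {σ B : Type*} [Fintype σ] [CommRing B] {k : ℕ}
    (x : {m : σ →₀ ℕ // m.degree = k} → B) : MvPolynomial σ B :=
  ∑ m, monomial m.1 (x m)

section

variable {σ B B' : Type*} [Fintype σ] [CommRing B] [CommRing B'] {k : ℕ}

theorem isHomogeneous_formOfCoeffs (x : {m : σ →₀ ℕ // m.degree = k} → B) :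
    (formOfCoeffs x).IsHomogeneous k :=
  IsHomogeneous.sum _ _ _ fun m _ => isHomogeneous_monomial _ m.2

theorem map_formOfCoeffs (φ : B →+* B') (x : {m : σ →₀ ℕ // m.degree = k} → B) :
    map φ (formOfCoeffs x) = formOfCoeffs fun m => φ (x m) := by
  simp [formOfCoeffs, map_monomial]

theorem formOfCoeffs_add (x y : {m : σ →₀ ℕ // m.degree = k} → B) :
    formOfCoeffs (x + y) = formOfCoeffs x + formOfCoeffs y := by
  simp [formOfCoeffs, Finset.sum_add_distrib]

theorem formOfCoeffs_smul (b : B) (x : {m : σ →₀ ℕ // m.degree = k} → B) :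
    formOfCoeffs (b • x) = b • formOfCoeffs x := by
  simp [formOfCoeffs, Finset.smul_sum, smul_monomial]

theorem coeff_formOfCoeffs (x : {m : σ →₀ ℕ // m.degree = k} → B)
    (m : {m : σ →₀ ℕ // m.degree = k}) : coeff m.1 (formOfCoeffs x) = x m := by
  classical
  simp only [formOfCoeffs, coeff_sum, coeff_monomial, Subtype.coe_inj]
  simp

theorem formOfCoeffs_coeff {F : MvPolynomial σ B} (hF : F.IsHomogeneous k) :
    formOfCoeffs (fun m : {m : σ →₀ ℕ // m.degree = k} => coeff m.1 F) = F :=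
  eq_of_isHomogeneous_of_coeff_eq (isHomogeneous_formOfCoeffs _) hF fun m => coeff_formOfCoeffs _ m

end

/-- Coefficients of the forms `f (t, i)` of degree `δ i` and their partners of degree `d - δ i`. -/
abbrev FactorIndex (d : ℕ) (δ : Fin 3 → ℕ) : Type :=
  Σ j : (Fin 2 × Fin 3) × Bool, {m : Fin 4 →₀ ℕ // m.degree = factorDegree d δ j}

/-- The form with index `j` from a family of coefficients. -/
noncomputable def factorForm {B : Type*} [CommRing B] {d : ℕ} {δ : Fin 3 → ℕ}
    (x : FactorIndex d δ → B) (j : (Fin 2 × Fin 3) × Bool) : MvPolynomial (Fin 4) B :=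
  formOfCoeffs fun m : {m : Fin 4 →₀ ℕ // m.degree = factorDegree d δ j} => x ⟨j, m⟩

section

variable {B B' : Type*} [CommRing B] [CommRing B'] {d : ℕ} {δ : Fin 3 → ℕ}

theorem isHomogeneous_factorForm (x : FactorIndex d δ → B) (j : (Fin 2 × Fin 3) × Bool) :
    (factorForm x j).IsHomogeneous (factorDegree d δ j) :=
  isHomogeneous_formOfCoeffs _

theorem factorForm_add (x y : FactorIndex d δ → B) (j : (Fin 2 × Fin 3) × Bool) :
    factorForm (x + y) j = factorForm x j + factorForm y j :=
  formOfCoeffs_add _ _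

theorem factorForm_smul (b : B) (x : FactorIndex d δ → B) (j : (Fin 2 × Fin 3) × Bool) :
    factorForm (b • x) j = b • factorForm x j :=
  formOfCoeffs_smul _ _

theorem map_factorForm (φ : B →+* B') (x : FactorIndex d δ → B)
    (j : (Fin 2 × Fin 3) × Bool) :
    map φ (factorForm x j) = factorForm (fun i => φ (x i)) j :=
  map_formOfCoeffs _ _

theorem exists_factorForm_eq {f : (Fin 2 × Fin 3) × Bool → MvPolynomial (Fin 4) B}
    (hf : ∀ j, (f j).IsHomogeneous (factorDegree d δ j)) :
    ∃ x : FactorIndex d δ → B, ∀ j, factorForm x j = f j :=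
  ⟨fun i => coeff i.2.1 (f i.1), fun j => formOfCoeffs_coeff (hf j)⟩

/-- The determinant whose non-vanishing makes the forms `f (t, i)`, `i < 3`, a regular sequence. -/
noncomputable def regularityDet (x : FactorIndex d δ → B) (t : Fin 2) : B :=
  substDivModDet (Fin.snoc (α := fun _ => ℕ) δ 1)
    (Fin.snoc (α := fun _ => MvPolynomial (Fin 4) B)
      (fun i : Fin 3 => factorForm x ((t, i), false)) (X (Fin.last 3)))

theorem map_regularityDet (φ : B →+* B') (x : FactorIndex d δ → B) (t : Fin 2) :
    φ (regularityDet x t) = regularityDet (fun i => φ (x i)) t := by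
  rw [regularityDet, map_substDivModDet, regularityDet]
  congr 1
  funext i
  refine Fin.lastCases ?_ (fun i => ?_) i
  · simp only [Fin.snoc_last, map_X]
  · simpa only [Fin.snoc_castSucc] using map_factorForm φ x ((t, i), false)

theorem exists_regularityDet_eq_one (d : ℕ) (δ : Fin 3 → ℕ) :
    ∃ x : FactorIndex d δ → B, ∀ t, regularityDet x t = 1 := by
  obtain ⟨x, hx⟩ := exists_factorForm_eq (B := B) (d := d) (δ := δ)
    (f := fun j => X j.1.2.castSucc ^ factorDegree d δ j) (fun j => isHomogeneous_X_pow _ _)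
  refine ⟨x, fun t => ?_⟩
  rw [regularityDet, ← substDivModDet_X_pow (σ := Fin 4) (e := Fin.snoc (α := fun _ => ℕ) δ 1)]
  congr 1
  funext i
  refine Fin.lastCases ?_ (fun i => ?_) i
  · simp only [Fin.snoc_last, pow_one]
  · simp only [Fin.snoc_castSucc, hx, factorDegree, cond_false]

theorem isRegSeq_of_regularityDet_ne_zero {x : FactorIndex d δ → ℂ} (hδ : ∀ i, 0 < δ i)
    {t : Fin 2} (h : regularityDet x t ≠ 0) :
    IsRegSeq (factorForm x ((t, 0), false)) (factorForm x ((t, 1), false))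
      (factorForm x ((t, 2), false)) := by
  have key := isRegSeq_of_substDivModDet_ne_zero (i := Fin.castSucc 0) (j := Fin.castSucc 1)
    (k := Fin.castSucc 2) ?_ ?_ h (by decide) (by decide) (by decide)
  · simpa only [Fin.snoc_castSucc] using key
  · intro i
    refine Fin.lastCases ?_ (fun i => ?_) i
    · simp only [Fin.snoc_last, zero_lt_one]
    · simpa only [Fin.snoc_castSucc] using hδ i
  · intro i
    refine Fin.lastCases ?_ (fun i => ?_) i
    · simpa only [Fin.snoc_last] using isHomogeneous_X _ _
    · simpa only [Fin.snoc_castSucc, factorDegree, cond_false] using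
        isHomogeneous_factorForm x ((t, i), false)

end

/-- The form `∑ f * f'` of degree `d`, bilinear in the coefficients of the forms `f` and of their
partners `f'`. -/
noncomputable def sumOfProducts {B : Type*} [CommRing B] {d : ℕ} {δ : Fin 3 → ℕ}
    (x y : FactorIndex d δ → B) (t : Fin 2) : MvPolynomial (Fin 4) B :=
  ∑ i, factorForm x ((t, i), false) * factorForm y ((t, i), true)

section

variable {B B' : Type*} [CommRing B] [CommRing B'] {d : ℕ} {δ : Fin 3 → ℕ}

theorem isHomogeneous_sumOfProducts (hδ : ∀ i, δ i ≤ d) (x y : FactorIndex d δ → B) (t : Fin 2) :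
    (sumOfProducts x y t).IsHomogeneous d := by
  refine IsHomogeneous.sum _ _ _ fun i _ => ?_
  have h := (isHomogeneous_factorForm x ((t, i), false)).mul
    (isHomogeneous_factorForm y ((t, i), true))
  simpa only [factorDegree, cond_true, cond_false, Nat.add_sub_cancel' (hδ i)] using h

theorem map_sumOfProducts (φ : B →+* B') (x y : FactorIndex d δ → B) (t : Fin 2) :
    map φ (sumOfProducts x y t) = sumOfProducts (fun i => φ (x i)) (fun i => φ (y i)) t := by
  simp only [sumOfProducts, map_sum, map_mul, map_factorForm]

/-- The coefficients of `∑ f * f'` as a bilinear map. -/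
noncomputable def sumOfProductsCoeff (d : ℕ) (δ : Fin 3 → ℕ) :
    (FactorIndex d δ → ℂ) →ₗ[ℂ] (FactorIndex d δ → ℂ) →ₗ[ℂ]
      ({m : Fin 4 →₀ ℕ // m.degree = d} → ℂ) :=
  LinearMap.mk₂ ℂ (fun x y k => coeff k.1 (∑ t, sumOfProducts x y t))
    (fun x x' y => by
      funext k
      simp only [sumOfProducts, factorForm_add, add_mul, Finset.sum_add_distrib, coeff_add,
        Pi.add_apply])
    (fun b x y => by
      funext k
      simp only [sumOfProducts, factorForm_smul, smul_mul_assoc, ← Finset.smul_sum, coeff_smul,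
        Pi.smul_apply])
    (fun x y y' => by
      funext k
      simp only [sumOfProducts, factorForm_add, mul_add, Finset.sum_add_distrib, coeff_add,
        Pi.add_apply])
    (fun b x y => by
      funext k
      simp only [sumOfProducts, factorForm_smul, mul_smul_comm, ← Finset.smul_sum, coeff_smul,
        Pi.smul_apply])

theorem exists_sumOfProductsCoeff_surjective (hδ : ∀ i, δ i ≤ d) :
    ∃ p : FactorIndex d δ → ℂ, ∀ y, ∃ v,
      sumOfProductsCoeff d δ p v + sumOfProductsCoeff d δ v p = y := by
  obtain ⟨L, hL, hgen⟩ := exists_forms_generating_degree hδ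
  obtain ⟨p, hp⟩ := exists_factorForm_eq hL
  refine ⟨p, fun y => ?_⟩
  obtain ⟨c, hc, hF⟩ := hgen (formOfCoeffs y) (isHomogeneous_formOfCoeffs y)
  obtain ⟨v, hv⟩ := exists_factorForm_eq (d := d) (δ := δ) (f := fun j => c (j.1, !j.2)) (by
    rintro ⟨⟨t, i⟩, s⟩
    have h := hc ((t, i), !s)
    have hi := hδ i
    cases s
    · simpa [factorDegree, Nat.sub_sub_self hi] using h
    · simpa [factorDegree] using h)
  refine ⟨v, ?_⟩
  funext k
  rw [← coeff_formOfCoeffs y k, hF]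
  change coeff k.1 (∑ t, sumOfProducts p v t) + coeff k.1 (∑ t, sumOfProducts v p t) = _
  rw [← coeff_add, ← Finset.sum_add_distrib]
  congr 1
  rw [Fintype.sum_prod_type, Fintype.sum_prod_type]
  refine Finset.sum_congr rfl fun t _ => ?_
  rw [sumOfProducts, sumOfProducts, ← Finset.sum_add_distrib]
  refine Finset.sum_congr rfl fun i _ => ?_
  rw [Fintype.sum_bool, hp, hp, hv, hv]
  simp only [Bool.not_true, Bool.not_false]
  ring

theorem containsCI_sumOfProducts (hδ : ∀ i, 0 < δ i) {x : FactorIndex d δ → ℂ} {t : Fin 2}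
    (h : regularityDet x t ≠ 0) : ContainsCI (sumOfProducts x x t) (δ 0) (δ 1) (δ 2) := by
  refine ⟨factorForm x ((t, 0), false), factorForm x ((t, 1), false),
    factorForm x ((t, 2), false), isHomogeneous_factorForm x ((t, 0), false),
    isHomogeneous_factorForm x ((t, 1), false), isHomogeneous_factorForm x ((t, 2), false),
    isRegSeq_of_regularityDet_ne_zero hδ h, ?_⟩
  rw [sumOfProducts, Fin.sum_univ_three]
  refine add_mem (add_mem ?_ ?_) ?_ <;>
    exact Ideal.mul_mem_right _ _ (Ideal.subset_span (by simp))

end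

theorem exists_ne_zero_forall_eq_sumOfProducts {d : ℕ} {δ : Fin 3 → ℕ} (hδ : ∀ i, δ i ≤ d) :
    ∃ P : MvPolynomial {m : Fin 4 →₀ ℕ // m.degree = d} ℂ, P ≠ 0 ∧
      ∀ F : MvPolynomial (Fin 4) ℂ, F.IsHomogeneous d → eval (fun m => coeff m.1 F) P ≠ 0 →
        ∃ x : FactorIndex d δ → ℂ, (∀ t, regularityDet x t ≠ 0) ∧
          F = ∑ t, sumOfProducts x x t := by
  let φ : {m : Fin 4 →₀ ℕ // m.degree = d} → MvPolynomial (FactorIndex d δ) ℂ := fun k =>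
    coeff k.1 (∑ t, sumOfProducts X X t)
  have hφ : ∀ x k, eval x (φ k) = coeff k.1 (∑ t, sumOfProducts x x t) := by
    intro x k
    simp only [φ, ← coeff_map, map_sum, map_sumOfProducts, eval_X]
  obtain ⟨p, hp⟩ := exists_sumOfProductsCoeff_surjective hδ
  have hinj := aeval_injective_of_bilinear_surjective φ (sumOfProductsCoeff d δ) hφ p hp
  let D : MvPolynomial (FactorIndex d δ) ℂ := ∏ t, regularityDet X t
  have hDx : ∀ x, eval x D = ∏ t, regularityDet x t := by
    intro x
    simp only [D, map_prod, map_regularityDet, eval_X]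
  have hD : D ≠ 0 := by
    obtain ⟨x, hx⟩ := exists_regularityDet_eq_one (B := ℂ) d δ
    intro h
    have h1 := hDx x
    simp [h, hx] at h1
  obtain ⟨P, hP0, hP⟩ := exists_eval_ne_zero_subset_image_of_aeval_injective φ hinj hD
  refine ⟨P, hP0, fun F hF hFP => ?_⟩
  obtain ⟨x, hx, hxF⟩ := hP _ hFP
  rw [hDx, Finset.prod_ne_zero_iff] at hx
  refine ⟨x, fun t => hx t (Finset.mem_univ t), ?_⟩
  refine eq_of_isHomogeneous_of_coeff_eq hF
    (IsHomogeneous.sum _ _ _ fun t _ => isHomogeneous_sumOfProducts hδ x x t) fun m => ?_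
  rw [← hφ, hxF]

/-- For any positive integers `d, a, b, c` with `d > a, b, c`, a general
form of degree `d` in four variables is a sum `F₁ + F₂` of two forms of degree `d`, each
of whose zero surfaces in `ℙ³` contains a complete intersection set of points of type
`(a, b, c)`. Genericity is expressed by a nonzero polynomial `P` in the coefficients of
the form, cutting out a nonempty Zariski-open subset of the space of forms of degree `d`. -/
theorem general_form_sum_of_two_forms_through_complete_intersections
    (d a b c : ℕ) (ha : 0 < a) (hb : 0 < b) (hc : 0 < c)
    (had : a < d) (hbd : b < d) (hcd : c < d) :
    ∃ P : MvPolynomial ((Fin 4) →₀ ℕ) ℂ, P ≠ 0 ∧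
      (∃ F : MvPolynomial (Fin 4) ℂ, F.IsHomogeneous d ∧
        MvPolynomial.eval (fun m => MvPolynomial.coeff m F) P ≠ 0) ∧
      ∀ F : MvPolynomial (Fin 4) ℂ, F.IsHomogeneous d →
        MvPolynomial.eval (fun m => MvPolynomial.coeff m F) P ≠ 0 →
        ∃ F₁ F₂ : MvPolynomial (Fin 4) ℂ,
          F₁.IsHomogeneous d ∧ F₂.IsHomogeneous d ∧ F = F₁ + F₂ ∧
          ContainsCI F₁ a b c ∧ ContainsCI F₂ a b c := by
  have hpos : ∀ i, 0 < ![a, b, c] i := by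
    intro i
    fin_cases i <;> assumption
  have hle : ∀ i, ![a, b, c] i ≤ d := by
    intro i
    fin_cases i
    · exact had.le
    · exact hbd.le
    · exact hcd.le
  obtain ⟨P, hP0, hP⟩ := exists_ne_zero_forall_eq_sumOfProducts hle
  have heval : ∀ F : MvPolynomial (Fin 4) ℂ,
      eval (fun m => coeff m F) (rename Subtype.val P) = eval (fun m => coeff m.1 F) P := by
    intro F
    rw [eval_rename]
    rfl
  refine ⟨rename Subtype.val P, ?_, ?_, fun F hF hFP => ?_⟩
  · rwa [ne_eq, map_eq_zero_iff _ (rename_injective _ Subtype.val_injective)]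
  · obtain ⟨y, hy⟩ : ∃ y, eval y P ≠ 0 := by
      by_contra! h
      exact hP0 (MvPolynomial.funext fun y => by rw [h y, map_zero])
    refine ⟨formOfCoeffs y, isHomogeneous_formOfCoeffs y, ?_⟩
    rw [heval]
    simpa only [coeff_formOfCoeffs] using hy
  · rw [heval] at hFP
    obtain ⟨x, hx, hxF⟩ := hP F hF hFP
    rw [Fin.sum_univ_two] at hxF
    exact ⟨_, _, isHomogeneous_sumOfProducts hle x x 0, isHomogeneous_sumOfProducts hle x x 1, hxF,
      containsCI_sumOfProducts hpos (hx 0), containsCI_sumOfProducts hpos (hx 1)⟩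
end

section
/- Let A = (a_{ij}) be a non-negative symmetric homogeneous integer matrix of even size 2k×2k with trace 2d. Then a general homogeneous form of degree d in three variables over ℂ is the Pfaffian of a skew-symmetric 2k×2k matrix G of homogeneous forms with degree matrix A. -/
open MvPolynomial

/-- The Pfaffian of a `2n × 2n` matrix of multivariate polynomials over `ℂ`,
given by the standard averaged signed sum over permutations. -/
noncomputable def pfaff {σ : Type*} {n : ℕ}
    (M : Matrix (Fin (2*n)) (Fin (2*n)) (MvPolynomial σ ℂ)) : MvPolynomial σ ℂ :=
  (((2^n * n.factorial : ℕ) : ℂ)⁻¹) •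
    ∑ p : Equiv.Perm (Fin (2*n)),
      (Equiv.Perm.sign p : ℤ) •
        ∏ i : Fin n, M (p ⟨2*i.1, by have := i.2; omega⟩) (p ⟨2*i.1+1, by have := i.2; omega⟩)

/-- A square matrix of polynomials is skew-symmetric. -/
def IsSkew {m : Type*} {R : Type*} [Ring R] (M : Matrix m m R) : Prop :=
  ∀ i j, M j i = - M i j

/-- A square integer matrix is homogeneous. -/
def HomogMat {m : Type*} (A : Matrix m m ℕ) : Prop :=
  ∀ i j l r, A i j + A l r = A i r + A l j

/-- A matrix of polynomials has degree matrix `A`. -/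
def DegMat {σ m : Type*} (M : Matrix m m (MvPolynomial σ ℂ)) (A : Matrix m m ℕ) : Prop :=
  ∀ i j, (M i j).IsHomogeneous (A i j)

/-- The set of submaximal Pfaffians of a skew-symmetric matrix of even size `2k`:
Pfaffians of the submatrices obtained by erasing two rows and the two columns
with the same indexes. -/
def submaxPfEven {σ : Type*} {k : ℕ}
    (M : Matrix (Fin (2*k)) (Fin (2*k)) (MvPolynomial σ ℂ)) : Set (MvPolynomial σ ℂ) :=
  { q | ∃ e : Fin (2*(k-1)) ↪o Fin (2*k), q = pfaff (M.submatrix e e) }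

/-- The set of submaximal Pfaffians of a skew-symmetric matrix of odd size `2k-1`:
Pfaffians of the submatrices obtained by erasing one row and the column
with the same index. -/
def submaxPfOdd {σ : Type*} {k : ℕ}
    (M : Matrix (Fin (2*k-1)) (Fin (2*k-1)) (MvPolynomial σ ℂ)) : Set (MvPolynomial σ ℂ) :=
  { q | ∃ e : Fin (2*(k-1)) ↪o Fin (2*k-1), q = pfaff (M.submatrix e e) }

/-- The Pfaffian over an arbitrary commutative `ℂ`-algebra. -/
noncomputable def pf {S : Type*} [CommRing S] [Algebra ℂ S] {n : ℕ}
    (M : Matrix (Fin (2*n)) (Fin (2*n)) S) : S :=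
  (((2^n * n.factorial : ℕ) : ℂ)⁻¹) •
    ∑ p : Equiv.Perm (Fin (2*n)),
      (Equiv.Perm.sign p : ℤ) •
        ∏ i : Fin n, M (p ⟨2*i.1, by have := i.2; omega⟩) (p ⟨2*i.1+1, by have := i.2; omega⟩)

section Pf

variable {S T : Type*} [CommRing S] [Algebra ℂ S] [CommRing T] [Algebra ℂ T] {n : ℕ}

lemma pf_map (f : S →ₐ[ℂ] T) (M : Matrix (Fin (2*n)) (Fin (2*n)) S) :
    pf (M.map f) = f (pf M) := by
  simp [pf, map_sum, map_prod, Matrix.map_apply]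

/-- The equivalence splitting `Fin (2 * n)` into consecutive pairs. -/
def pairEquiv (n : ℕ) : Fin n × Fin 2 ≃ Fin (2*n) :=
  finProdFinEquiv.trans (finCongr (Nat.mul_comm n 2))

lemma pairEquiv_zero (i : Fin n) :
    pairEquiv n (i, 0) = ⟨2*i.1, by have := i.2; omega⟩ := by
  ext; simp [pairEquiv]

lemma pairEquiv_one (i : Fin n) :
    pairEquiv n (i, 1) = ⟨2*i.1+1, by have := i.2; omega⟩ := by
  ext; simp [pairEquiv]; omega

omit [Algebra ℂ S] in
lemma prod_fin_two_mul (f : Fin (2*n) → S) :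
    ∏ l, f l = ∏ i : Fin n, f ⟨2*i.1, by have := i.2; omega⟩ *
      f ⟨2*i.1+1, by have := i.2; omega⟩ := by
  rw [← (pairEquiv n).prod_comp, Fintype.prod_prod_type]
  refine Finset.prod_congr rfl fun i _ => ?_
  rw [Fin.prod_univ_two, pairEquiv_zero, pairEquiv_one]

omit [Algebra ℂ S] in
lemma prod_congruence_apply (U M : Matrix (Fin (2*n)) (Fin (2*n)) S) (p : Equiv.Perm (Fin (2*n))) :
    ∏ i : Fin n, (U * M * U.transpose) (p ⟨2*i.1, by have := i.2; omega⟩)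
      (p ⟨2*i.1+1, by have := i.2; omega⟩) =
    ∑ g : Fin (2*n) → Fin (2*n),
      (∏ i : Fin n, M (g ⟨2*i.1, by have := i.2; omega⟩) (g ⟨2*i.1+1, by have := i.2; omega⟩)) *
        ∏ l, U (p l) (g l) := by
  have h1 : ∀ a b, (U * M * U.transpose) a b =
      ∑ c : Fin 2 → Fin (2*n), U a (c 0) * M (c 0) (c 1) * U b (c 1) := by
    intro a b
    rw [← (finTwoArrowEquiv (Fin (2*n))).symm.sum_comp, Fintype.sum_prod_type, Finset.sum_comm]
    simp [Matrix.mul_apply, Finset.sum_mul]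
  simp_rw [h1]
  rw [Finset.prod_univ_sum, Fintype.piFinset_univ]
  rw [← ((Equiv.curry _ _ _).symm.trans ((pairEquiv n).arrowCongr (Equiv.refl _))).sum_comp]
  refine Finset.sum_congr rfl fun c _ => ?_
  rw [prod_fin_two_mul (fun l => U (p l) _), ← Finset.prod_mul_distrib]
  refine Finset.prod_congr rfl fun i _ => ?_
  simp only [← pairEquiv_zero, ← pairEquiv_one]
  simp [Equiv.arrowCongr, Function.uncurry]
  ring

lemma pf_congruence (U M : Matrix (Fin (2*n)) (Fin (2*n)) S) :
    pf (U * M * U.transpose) = U.det * pf M := by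
  unfold pf
  rw [mul_smul_comm]
  congr 1
  simp_rw [prod_congruence_apply, Finset.smul_sum]
  rw [Finset.sum_comm]
  have key : ∀ g : Fin (2*n) → Fin (2*n),
      ∑ p : Equiv.Perm (Fin (2*n)), (Equiv.Perm.sign p : ℤ) •
        ((∏ i : Fin n, M (g ⟨2*i.1, by have := i.2; omega⟩) (g ⟨2*i.1+1, by have := i.2; omega⟩)) *
        ∏ l, U (p l) (g l)) =
      (∏ i : Fin n, M (g ⟨2*i.1, by have := i.2; omega⟩) (g ⟨2*i.1+1, by have := i.2; omega⟩)) *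
        (U.submatrix id g).det := by
    intro g
    rw [Matrix.det_apply, Finset.mul_sum]
    refine Finset.sum_congr rfl fun p _ => ?_
    simp [Units.smul_def]
    ring
  simp_rw [key]
  have inj : ∀ g : Fin (2*n) → Fin (2*n), ¬ Function.Bijective g →
      (∏ i : Fin n, M (g ⟨2*i.1, by have := i.2; omega⟩) (g ⟨2*i.1+1, by have := i.2; omega⟩)) *
        (U.submatrix id g).det = 0 := by
    intro g hg
    have : ¬ Function.Injective g := fun h => hg (Finite.injective_iff_bijective.mp h)
    simp only [Function.Injective, not_forall] at this
    obtain ⟨a, b, hab, hne⟩ := this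
    rw [Matrix.det_zero_of_column_eq hne (fun i => by simp [hab]), mul_zero]
  rw [← Finset.sum_filter_of_ne (p := Function.Bijective)
    (fun g _ h => by by_contra hb; exact h (inj g hb))]
  rw [Finset.mul_sum]
  symm
  refine Finset.sum_bij (fun p _ => (p : Fin (2*n) → Fin (2*n))) ?_ ?_ ?_ ?_
  · intro p _; exact Finset.mem_filter.mpr ⟨Finset.mem_univ _, p.bijective⟩
  · intro p _ q _ h; exact DFunLike.coe_injective h
  · intro g hg
    exact ⟨Equiv.ofBijective g (Finset.mem_filter.mp hg).2, Finset.mem_univ _, rfl⟩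
  · intro p _
    rw [Matrix.det_permute']
    simp only [zsmul_eq_mul]
    ring

end Pf

/-- The standard symplectic matrix: blocks `[[0, 1], [-1, 0]]` along the diagonal. -/
def stdSympl (S : Type*) [CommRing S] (n : ℕ) : Matrix (Fin (2*n)) (Fin (2*n)) S :=
  fun a b => if a.1 / 2 = b.1 / 2 then (((b.1 : ℤ) - (a.1 : ℤ) : ℤ) : S) else 0

lemma exists_blocks_of_stdSympl_ne_zero {n : ℕ} (p : Equiv.Perm (Fin (2*n)))
    (h : ∀ i : Fin n, (p ⟨2*i.1, by have := i.2; omega⟩).1 / 2 =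
      (p ⟨2*i.1+1, by have := i.2; omega⟩).1 / 2) :
    ∃ (π : Equiv.Perm (Fin n)) (f : Fin n → Equiv.Perm (Fin 2)),
      ∀ i x, p (pairEquiv n (i, x)) = pairEquiv n (π i, f i x) := by
  set e := pairEquiv n with he
  have hval : ∀ z : Fin n × Fin 2, (e z).1 = 2 * z.1.1 + z.2.1 := by
    rintro ⟨i, x⟩
    fin_cases x
    · simp [he, pairEquiv_zero]
    · simp [he, pairEquiv_one]
  let p' : Equiv.Perm (Fin n × Fin 2) := e.trans (p.trans e.symm)
  have hp' : ∀ z, p (e z) = e (p' z) := by intro z; simp [p']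
  have hblock : ∀ i x, (p' (i, x)).1 = (p' (i, 0)).1 := by
    intro i x
    fin_cases x
    · rfl
    · have h1 := h i
      rw [← pairEquiv_zero, ← pairEquiv_one, ← he, hp', hp', hval, hval] at h1
      ext
      have := (p' (i, 0)).2.2
      have := (p' (i, 1)).2.2
      change (p' (i, 1)).1.1 = _
      omega
  have hf : ∀ i, Function.Bijective (fun x => (p' (i, x)).2) := by
    intro i
    refine Finite.injective_iff_bijective.mp fun x y hxy => ?_
    have : p' (i, x) = p' (i, y) := Prod.ext ((hblock i x).trans (hblock i y).symm) hxy
    simpa using this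
  have hπ : Function.Bijective (fun i => (p' (i, 0)).1) := by
    refine Finite.injective_iff_bijective.mp fun i j hij => ?_
    obtain ⟨x, hx⟩ := (hf j).2 (p' (i, 0)).2
    have : p' (i, 0) = p' (j, x) := Prod.ext (by rw [hblock j x]; exact hij) hx.symm
    simpa using congrArg Prod.fst (p'.injective this)
  refine ⟨Equiv.ofBijective _ hπ, fun i => Equiv.ofBijective _ (hf i), fun i x => ?_⟩
  rw [hp']
  congr 1
  exact Prod.ext (hblock i x) rfl

lemma sign_of_blocks {n : ℕ} (p : Equiv.Perm (Fin (2*n)))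
    (π : Equiv.Perm (Fin n)) (f : Fin n → Equiv.Perm (Fin 2))
    (h : ∀ i x, p (pairEquiv n (i, x)) = pairEquiv n (π i, f i x)) :
    Equiv.Perm.sign p = ∏ i, Equiv.Perm.sign (f i) := by
  have hp : p = (pairEquiv n).permCongr
      (Equiv.prodCongrLeft (fun _ => π) * Equiv.prodCongrRight f) := by
    ext a
    obtain ⟨⟨i, x⟩, rfl⟩ := (pairEquiv n).surjective a
    simp [h]
  rw [hp, Equiv.Perm.sign_permCongr, map_mul, Equiv.Perm.sign_prodCongrLeft,
    Equiv.Perm.sign_prodCongrRight]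
  simp

lemma perm_fin_two_sub (f : Equiv.Perm (Fin 2)) :
    ((f 1).1 : ℤ) - ((f 0).1 : ℤ) = (Equiv.Perm.sign f : ℤ) := by
  revert f; decide

lemma stdSympl_term {n : ℕ} (p : Equiv.Perm (Fin (2*n))) :
    (Equiv.Perm.sign p : ℤ) * ∏ i : Fin n, stdSympl ℤ n
      (p ⟨2*i.1, by have := i.2; omega⟩) (p ⟨2*i.1+1, by have := i.2; omega⟩) =
    if (∀ i : Fin n, (p ⟨2*i.1, by have := i.2; omega⟩).1 / 2 =
      (p ⟨2*i.1+1, by have := i.2; omega⟩).1 / 2) then 1 else 0 := by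
  split_ifs with h
  · obtain ⟨π, f, hf⟩ := exists_blocks_of_stdSympl_ne_zero p h
    rw [sign_of_blocks p π f hf, Units.coe_prod, ← Finset.prod_mul_distrib]
    refine Finset.prod_eq_one fun i _ => ?_
    rw [stdSympl, if_pos (h i), ← pairEquiv_zero, ← pairEquiv_one, hf, hf]
    have hval : ∀ z : Fin n × Fin 2, ((pairEquiv n z).1 : ℤ) = 2 * z.1.1 + z.2.1 := by
      rintro ⟨i, x⟩
      fin_cases x
      · simp [pairEquiv_zero]
      · simp [pairEquiv_one]
    rw [hval, hval]
    have := perm_fin_two_sub (f i)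
    simp only [add_sub_add_left_eq_sub, this, Int.cast_id]
    exact Int.units_coe_mul_self _
  · push Not at h
    obtain ⟨i, hi⟩ := h
    rw [Finset.prod_eq_zero (Finset.mem_univ i), mul_zero]
    rw [stdSympl, if_neg hi]

lemma pf_stdSympl_ne_zero (n : ℕ) : pf (stdSympl ℂ n) ≠ 0 := by
  have h1 : ∑ p : Equiv.Perm (Fin (2*n)), (Equiv.Perm.sign p : ℤ) •
        ∏ i : Fin n, stdSympl ℂ n (p ⟨2*i.1, by have := i.2; omega⟩)
          (p ⟨2*i.1+1, by have := i.2; omega⟩) =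
      ((∑ p : Equiv.Perm (Fin (2*n)), if (∀ i : Fin n, (p ⟨2*i.1, by have := i.2; omega⟩).1 / 2 =
      (p ⟨2*i.1+1, by have := i.2; omega⟩).1 / 2) then (1:ℤ) else 0 : ℤ) : ℂ) := by
    rw [Int.cast_sum]
    refine Finset.sum_congr rfl fun p _ => ?_
    rw [← stdSympl_term, Int.cast_mul, Int.cast_prod, zsmul_eq_mul]
    congr 1
    refine Finset.prod_congr rfl fun i _ => ?_
    simp [stdSympl]
  unfold pf
  rw [h1]
  refine smul_ne_zero (inv_ne_zero (Nat.cast_ne_zero.mpr (by positivity))) ?_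
  rw [Int.cast_ne_zero]
  refine (Finset.sum_pos' (fun p _ => by split_ifs <;> norm_num) ⟨1, Finset.mem_univ _, ?_⟩).ne'
  rw [if_pos]
  · norm_num
  · intro i; simp; omega

lemma stdSympl_map {S T : Type*} [CommRing S] [CommRing T] (f : S →+* T) (n : ℕ) :
    (stdSympl S n).map f = stdSympl T n := by
  ext a b; simp only [Matrix.map_apply, stdSympl]; split_ifs <;> simp

section Derivative

variable {S T : Type*} [CommRing S] [Algebra ℂ S] [CommRing T] [Algebra ℂ T] {n : ℕ}

/-- The derivative of the Pfaffian at `M` in the direction `H`. -/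
noncomputable def dpf (M H : Matrix (Fin (2*n)) (Fin (2*n)) S) : S :=
  (((2^n * n.factorial : ℕ) : ℂ)⁻¹) •
    ∑ p : Equiv.Perm (Fin (2*n)),
      (Equiv.Perm.sign p : ℤ) •
        ∑ i : Fin n, H (p ⟨2*i.1, by have := i.2; omega⟩) (p ⟨2*i.1+1, by have := i.2; omega⟩) *
          ∏ j ∈ Finset.univ.erase i,
            M (p ⟨2*j.1, by have := j.2; omega⟩) (p ⟨2*j.1+1, by have := j.2; omega⟩)

lemma dpf_add (M H K : Matrix (Fin (2*n)) (Fin (2*n)) S) :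
    dpf M (H + K) = dpf M H + dpf M K := by
  simp only [dpf, Matrix.add_apply, add_mul, Finset.sum_add_distrib, smul_add]

lemma dpf_smul (M H : Matrix (Fin (2*n)) (Fin (2*n)) S) (c : S) :
    dpf M (c • H) = c * dpf M H := by
  simp only [dpf, Matrix.smul_apply, smul_eq_mul, mul_assoc, ← Finset.mul_sum]
  simp only [zsmul_eq_mul, mul_left_comm _ c, ← Finset.mul_sum, mul_smul_comm]

/-- `dpf M` as a linear map in the direction. -/
noncomputable def dpfLin (M : Matrix (Fin (2*n)) (Fin (2*n)) S) :
    Matrix (Fin (2*n)) (Fin (2*n)) S →ₗ[S] S where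
  toFun := dpf M
  map_add' := dpf_add M
  map_smul' c H := dpf_smul M H c

/-- The matrix `M + ε H` over the dual numbers. -/
def dualMat (M H : Matrix (Fin (2*n)) (Fin (2*n)) S) :
    Matrix (Fin (2*n)) (Fin (2*n)) (DualNumber S) :=
  fun i j => TrivSqZeroExt.inl (M i j) + TrivSqZeroExt.inr (H i j)

omit [Algebra ℂ S] in
lemma prod_inl_add_inr {ι : Type*} [DecidableEq ι] (s : Finset ι) (f g : ι → S) :
    ∏ i ∈ s, ((TrivSqZeroExt.inl (f i) + TrivSqZeroExt.inr (g i) : DualNumber S)) =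
      TrivSqZeroExt.inl (∏ i ∈ s, f i) +
        TrivSqZeroExt.inr (∑ i ∈ s, g i * ∏ j ∈ s.erase i, f j) := by
  induction s using Finset.induction_on with
  | empty => simp
  | insert a s ha ih =>
    rw [Finset.prod_insert ha, ih, Finset.prod_insert ha, Finset.sum_insert ha,
      Finset.erase_insert ha]
    have : ∑ i ∈ s, g i * ∏ j ∈ (insert a s).erase i, f j =
        f a * ∑ i ∈ s, g i * ∏ j ∈ s.erase i, f j := by
      rw [Finset.mul_sum]
      refine Finset.sum_congr rfl fun i hi => ?_
      have hne : a ≠ i := fun h => ha (h ▸ hi)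
      rw [Finset.erase_insert_of_ne hne, Finset.prod_insert (by simp [ha])]
      ring
    rw [this]
    ext
    · simp
    · simp [mul_comm]; ring

lemma pf_dualMat (M H : Matrix (Fin (2*n)) (Fin (2*n)) S) :
    pf (dualMat M H) = TrivSqZeroExt.inl (pf M) + TrivSqZeroExt.inr (dpf M H) := by
  simp only [pf, dpf, dualMat, prod_inl_add_inr]
  ext
  · simp [TrivSqZeroExt.fst_sum]
  · simp only [TrivSqZeroExt.snd_smul, TrivSqZeroExt.snd_sum, TrivSqZeroExt.snd_add,
      TrivSqZeroExt.snd_inl, TrivSqZeroExt.snd_inr, zero_add]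

lemma snd_pf_dualMat (M H : Matrix (Fin (2*n)) (Fin (2*n)) S) :
    (pf (dualMat M H)).snd = dpf M H := by
  simp [pf_dualMat]

lemma dpf_congruence (U M H : Matrix (Fin (2*n)) (Fin (2*n)) S) :
    dpf (U * M * U.transpose) (U * H * U.transpose) = U.det * dpf M H := by
  let f := TrivSqZeroExt.inlHom S S
  have h : dualMat (U * M * U.transpose) (U * H * U.transpose) =
      U.map f * dualMat M H * (U.map f).transpose := by
    have h1 : ∀ A B : Matrix (Fin (2*n)) (Fin (2*n)) S,
        dualMat A B = A.map f + (DualNumber.eps : DualNumber S) • B.map f := by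
      intro A B
      ext i j
      · simp [dualMat, f]
      · simp [dualMat, f]
    rw [h1, h1]
    simp only [Matrix.map_mul, Matrix.transpose_map, mul_add, add_mul, Matrix.mul_smul,
      Matrix.smul_mul]
  rw [← snd_pf_dualMat, h, pf_congruence, pf_dualMat]
  have : (U.map f).det = TrivSqZeroExt.inl U.det := (RingHom.map_det f U).symm
  simp [this]

/-- The elementary skew-symmetric matrix `u vᵀ - v uᵀ`. -/
def wedge (u v : Fin (2*n) → S) : Matrix (Fin (2*n)) (Fin (2*n)) S :=
  Matrix.vecMulVec u v - Matrix.vecMulVec v u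

omit [Algebra ℂ S] in
lemma congruence_wedge (U : Matrix (Fin (2*n)) (Fin (2*n)) S) (u v : Fin (2*n) → S) :
    U * wedge u v * U.transpose = wedge (U.mulVec u) (U.mulVec v) := by
  simp [wedge, mul_sub, sub_mul, Matrix.mul_vecMulVec, Matrix.vecMulVec_mul,
    Matrix.vecMul_transpose]

/-- The derivative of the Pfaffian in the direction of the pair of entries `(i, j)`, `(j, i)`;
up to sign this is the Pfaffian of the matrix with the rows and columns `i, j` erased. -/
noncomputable def subPf (M : Matrix (Fin (2*n)) (Fin (2*n)) S) (i j : Fin (2*n)) : S :=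
  dpf M (wedge (Pi.single i 1) (Pi.single j 1))

omit [Algebra ℂ S] in
lemma wedge_swap (u v : Fin (2*n) → S) : wedge u v = - wedge v u := by simp [wedge]

lemma dpf_wedge_swap (M : Matrix (Fin (2*n)) (Fin (2*n)) S) (u v : Fin (2*n) → S) :
    dpf M (wedge u v) = - dpf M (wedge v u) := by
  rw [wedge_swap]; exact map_neg (dpfLin M) _

lemma subPf_swap (M : Matrix (Fin (2*n)) (Fin (2*n)) S) (i j : Fin (2*n)) :
    subPf M i j = - subPf M j i := dpf_wedge_swap ..

lemma dpf_wedge_add_left (M : Matrix (Fin (2*n)) (Fin (2*n)) S) (u u' v : Fin (2*n) → S) :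
    dpf M (wedge (u + u') v) = dpf M (wedge u v) + dpf M (wedge u' v) := by
  rw [← dpf_add]; congr 1; simp only [wedge, Matrix.add_vecMulVec, Matrix.vecMulVec_add]; abel

lemma dpf_wedge_smul_left (M : Matrix (Fin (2*n)) (Fin (2*n)) S) (c : S) (u v : Fin (2*n) → S) :
    dpf M (wedge (c • u) v) = c * dpf M (wedge u v) := by
  rw [← dpf_smul]; congr 1; simp only [wedge, Matrix.smul_vecMulVec, Matrix.vecMulVec_smul,
    smul_sub]

lemma dpf_wedge_add_right (M : Matrix (Fin (2*n)) (Fin (2*n)) S) (u v v' : Fin (2*n) → S) :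
    dpf M (wedge u (v + v')) = dpf M (wedge u v) + dpf M (wedge u v') := by
  rw [dpf_wedge_swap, dpf_wedge_add_left, dpf_wedge_swap M v, dpf_wedge_swap M v']; ring

lemma dpf_wedge_smul_right (M : Matrix (Fin (2*n)) (Fin (2*n)) S) (c : S) (u v : Fin (2*n) → S) :
    dpf M (wedge u (c • v)) = c * dpf M (wedge u v) := by
  rw [dpf_wedge_swap, dpf_wedge_smul_left, dpf_wedge_swap M v]; ring

lemma subPf_self [IsDomain S] [CharZero S] (M : Matrix (Fin (2*n)) (Fin (2*n)) S) (i : Fin (2*n)) :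
    subPf M i i = 0 := self_eq_neg.mp (subPf_swap M i i)

/-- Scaling of `subPf` under a diagonal congruence. -/
lemma mul_subPf_diagonal (D : Fin (2*n) → S) (M : Matrix (Fin (2*n)) (Fin (2*n)) S)
    (i j : Fin (2*n)) :
    D i * D j * subPf (Matrix.diagonal D * M * Matrix.diagonal D) i j =
      (∏ l, D l) * subPf M i j := by
  have h := dpf_congruence (Matrix.diagonal D) M (wedge (Pi.single i 1) (Pi.single j 1))
  rw [congruence_wedge, Matrix.det_diagonal, Matrix.diagonal_transpose] at h
  have hs : ∀ l, (Matrix.diagonal D).mulVec (Pi.single l 1) = D l • Pi.single l 1 := by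
    intro l
    ext m
    by_cases hm : m = l
    · subst hm; simp
    · simp [Matrix.mulVec_single, hm]
  rw [hs, hs, dpf_wedge_smul_left, dpf_wedge_smul_right] at h
  rw [subPf, subPf, ← h, mul_assoc]

end Derivative

section BaseMatrix

variable {S : Type*} [CommRing S] [Algebra ℂ S] {n : ℕ}

lemma subPf_stdSympl_pair {a b : Fin (2*n)} (ha : a.1 % 2 = 0) (hb : b.1 = a.1 + 1) :
    subPf (stdSympl S n) a b = pf (stdSympl S n) := by
  let f := TrivSqZeroExt.inlHom S S
  let D : Fin (2*n) → DualNumber S := Function.update 1 a (1 + DualNumber.eps)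
  have hab : a ≠ b := fun h => by rw [h] at hb; omega
  have h : dualMat (stdSympl S n) (wedge (Pi.single a 1) (Pi.single b 1)) =
      Matrix.diagonal D * (stdSympl S n).map f * (Matrix.diagonal D).transpose := by
    rw [Matrix.diagonal_transpose]
    refine Matrix.ext fun i j => ?_
    rw [Matrix.mul_diagonal, Matrix.diagonal_mul]
    simp only [dualMat, wedge, Matrix.sub_apply, Matrix.vecMulVec_apply, Matrix.map_apply, D,
      Function.update_apply, Pi.one_apply, Pi.single_apply, stdSympl]
    by_cases hia : i = a
    · subst hia
      by_cases hji : j = i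
      · subst hji; ext <;> simp [f, hab]
      · by_cases hjb : j = b
        · subst hjb
          have : i.1 / 2 = (i.1 + 1) / 2 := by omega
          ext <;> simp [f, hab, hab.symm, this, hb]
        · have : ¬ i.1 / 2 = j.1 / 2 := fun h => by
            have := Fin.val_ne_of_ne hji
            have := Fin.val_ne_of_ne hjb
            omega
          ext <;> simp [f, hab, hji, hjb, this]
    · by_cases hja : j = a
      · subst hja
        by_cases hib : i = b
        · subst hib
          have : (j.1 + 1) / 2 = j.1 / 2 := by omega
          ext <;> simp [f, hab, hab.symm, this, hb]
        · have : ¬ i.1 / 2 = j.1 / 2 := fun h => by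
            have := Fin.val_ne_of_ne hia
            have := Fin.val_ne_of_ne hib
            omega
          ext <;> simp [f, hab, hia, hib, this]
      · ext <;> simp [f, hia, hja]
  rw [subPf, ← snd_pf_dualMat, h, pf_congruence, Matrix.det_diagonal]
  have h2 : (stdSympl S n).map f = dualMat (stdSympl S n) 0 := by
    ext i j <;> simp [f, dualMat]
  have h3 : dpf (stdSympl S n) 0 = 0 := map_zero (dpfLin _)
  rw [h2, pf_dualMat, h3, Finset.prod_update_of_mem (Finset.mem_univ a)]
  simp

lemma subPf_stdSympl_of_ne [IsDomain S] [CharZero S] {a b : Fin (2*n)} (hab : a.1 / 2 ≠ b.1 / 2) :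
    subPf (stdSympl S n) a b = 0 := by
  let D : Fin (2*n) → S := fun l => if l.1 / 2 = a.1 / 2 then -1 else 1
  have h := mul_subPf_diagonal D (stdSympl S n) a b
  have h1 : Matrix.diagonal D * stdSympl S n * Matrix.diagonal D = stdSympl S n := by
    ext i j
    rw [Matrix.mul_diagonal, Matrix.diagonal_mul]
    simp only [stdSympl, D]
    split_ifs <;> first | omega | simp
  have h2 : ∏ l, D l = 1 := by
    rw [prod_fin_two_mul]
    refine Finset.prod_eq_one fun i _ => ?_
    have : (2 * i.1 + 1) / 2 = 2 * i.1 / 2 := by omega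
    simp only [D, this]
    split_ifs <;> simp
  rw [h1, h2] at h
  simp only [D, if_neg hab.symm, if_true] at h
  exact (self_eq_neg.mp (by linear_combination -h))

/-- The matrix `M` with the row and the column of index `i` scaled by `P`. -/
def scaleAt (P : S) (i : Fin (2*n)) (M : Matrix (Fin (2*n)) (Fin (2*n)) S) :
    Matrix (Fin (2*n)) (Fin (2*n)) S :=
  Matrix.diagonal (Function.update 1 i P) * M * Matrix.diagonal (Function.update 1 i P)

omit [Algebra ℂ S] in
lemma scaleAt_apply (P : S) (i : Fin (2*n)) (M : Matrix (Fin (2*n)) (Fin (2*n)) S)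
    (a b : Fin (2*n)) :
    scaleAt P i M a b = (if a = i then P else 1) * M a b * (if b = i then P else 1) := by
  rw [scaleAt, Matrix.mul_diagonal, Matrix.diagonal_mul, Function.update_apply,
    Function.update_apply, Pi.one_apply, Pi.one_apply]

lemma subPf_scaleAt_left [IsDomain S] [CharZero S] {P : S} (hP : P ≠ 0) (i : Fin (2*n))
    (M : Matrix (Fin (2*n)) (Fin (2*n)) S) (b : Fin (2*n)) :
    subPf (scaleAt P i M) i b = subPf M i b := by
  by_cases hb : b = i
  · rw [hb, subPf_self, subPf_self]
  have h := mul_subPf_diagonal (Function.update 1 i P) M i b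
  rw [Finset.prod_update_of_mem (Finset.mem_univ _), Function.update_self,
    Function.update_of_ne hb] at h
  simp only [Pi.one_apply, mul_one, Finset.prod_const_one] at h
  exact mul_left_cancel₀ hP h

lemma subPf_scaleAt_right [IsDomain S] [CharZero S] {P : S} (hP : P ≠ 0) (i : Fin (2*n))
    (M : Matrix (Fin (2*n)) (Fin (2*n)) S) (a : Fin (2*n)) :
    subPf (scaleAt P i M) a i = subPf M a i := by
  rw [subPf_swap, subPf_scaleAt_left hP, ← subPf_swap]

lemma subPf_scaleAt_of_ne (P : S) {i : Fin (2*n)} (M : Matrix (Fin (2*n)) (Fin (2*n)) S)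
    {a b : Fin (2*n)} (ha : a ≠ i) (hb : b ≠ i) :
    subPf (scaleAt P i M) a b = P * subPf M a b := by
  have h := mul_subPf_diagonal (Function.update 1 i P) M a b
  rw [Finset.prod_update_of_mem (Finset.mem_univ _), Function.update_of_ne ha,
    Function.update_of_ne hb] at h
  simpa [scaleAt] using h

/-- The unipotent matrix whose inverse adds `μ j` times the first and `ν j` times the second
basis vector to the `j`-th one. -/
def unipotent (hn : 0 < n) (μ ν : Fin (2*n) → S) : Matrix (Fin (2*n)) (Fin (2*n)) S :=
  1 - Matrix.vecMulVec (Pi.single ⟨0, by omega⟩ 1) μ - Matrix.vecMulVec (Pi.single ⟨1, by omega⟩ 1) ν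

section Unipotent

variable (hn : 0 < n) {μ ν : Fin (2*n) → S} (hμ : ∀ j, j.1 < 2 → μ j = 0)
  (hν : ∀ j, j.1 < 2 → ν j = 0)
include hμ hν

omit [Algebra ℂ S] in
lemma det_unipotent : (unipotent hn μ ν).det = 1 := by
  rw [Matrix.det_of_isUpperTriangular]
  · refine Finset.prod_eq_one fun i _ => ?_
    simp only [unipotent, Matrix.sub_apply, Matrix.vecMulVec_apply, Pi.single_apply,
      Matrix.one_apply_eq]
    split_ifs with h h'
    · simp [hμ i (by rw [h]; simp), hν i (by rw [h]; simp)]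
    · simp [hμ i (by rw [h]; simp)]
    · rename_i h'
      simp [hν i (by rw [h']; simp)]
    · simp
  · intro i j hij
    have hij' : j.1 < i.1 := hij
    have h1 : (1 : Matrix (Fin (2*n)) (Fin (2*n)) S) i j = 0 :=
      Matrix.one_apply_ne (Fin.ne_of_gt hij)
    simp only [unipotent, Matrix.sub_apply, Matrix.vecMulVec_apply, Pi.single_apply,
      h1, Fin.ext_iff]
    split_ifs <;> first | omega | simp [hν j (by omega)] | simp

omit [Algebra ℂ S] in
lemma unipotent_mulVec (j : Fin (2*n)) :
    (unipotent hn μ ν).mulVec (Pi.single j 1 + μ j • Pi.single ⟨0, by omega⟩ 1 +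
      ν j • Pi.single ⟨1, by omega⟩ 1) = Pi.single j 1 := by
  have h0 := hμ ⟨0, by omega⟩ (by simp)
  have h1 := hμ ⟨1, by omega⟩ (by simp)
  have h2 := hν ⟨0, by omega⟩ (by simp)
  have h3 := hν ⟨1, by omega⟩ (by simp)
  simp only [unipotent, Matrix.sub_mulVec, Matrix.one_mulVec, Matrix.vecMulVec_mulVec,
    dotProduct_add, dotProduct_smul, dotProduct_single, h0, h1, h2, h3]
  ext l
  simp [Pi.single_apply]
  ring

/-- The submaximal Pfaffians after the base change by `unipotent`. -/
lemma subPf_unipotent [IsDomain S] [CharZero S] (M : Matrix (Fin (2*n)) (Fin (2*n)) S)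
    (i j : Fin (2*n)) :
    subPf (unipotent hn μ ν * M * (unipotent hn μ ν).transpose) i j =
      subPf M i j + μ j * subPf M i ⟨0, by omega⟩ + ν j * subPf M i ⟨1, by omega⟩
      - μ i * subPf M j ⟨0, by omega⟩ - ν i * subPf M j ⟨1, by omega⟩
      + (μ i * ν j - ν i * μ j) * subPf M ⟨0, by omega⟩ ⟨1, by omega⟩ := by
  conv_lhs =>
    rw [subPf, ← unipotent_mulVec hn hμ hν i, ← unipotent_mulVec hn hμ hν j, ← congruence_wedge,
      dpf_congruence, det_unipotent hn hμ hν, one_mul]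
  simp only [dpf_wedge_add_left, dpf_wedge_add_right, dpf_wedge_smul_left, dpf_wedge_smul_right]
  have hs : ∀ a b, dpf M (wedge (Pi.single a 1) (Pi.single b 1)) = subPf M a b := fun _ _ => rfl
  simp only [hs]
  rw [subPf_self, subPf_self, subPf_swap M ⟨0, by omega⟩ j, subPf_swap M ⟨1, by omega⟩ j,
    subPf_swap M ⟨1, by omega⟩ ⟨0, by omega⟩]
  ring

end Unipotent

end BaseMatrix

section Forms

/-- `f` is zero or homogeneous with twice its degree equal to `w`. -/
def HasTwiceDegree (f : MvPolynomial (Fin 3) ℂ) (w : ℤ) : Prop :=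
  f = 0 ∨ ∃ N : ℕ, 2 * (N : ℤ) = w ∧ f.IsHomogeneous N

namespace HasTwiceDegree

variable {f g : MvPolynomial (Fin 3) ℂ} {v w : ℤ}

lemma zero (w : ℤ) : HasTwiceDegree 0 w := Or.inl rfl

lemma of_isHomogeneous {N : ℕ} (h : f.IsHomogeneous N) : HasTwiceDegree f (2 * N) :=
  Or.inr ⟨N, rfl, h⟩

lemma C (c : ℂ) : HasTwiceDegree (MvPolynomial.C c) 0 := Or.inr ⟨0, by simp, isHomogeneous_C _ c⟩

lemma one : HasTwiceDegree 1 0 := HasTwiceDegree.C 1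

lemma X (i : Fin 3) : HasTwiceDegree (MvPolynomial.X i) 2 := Or.inr ⟨1, by simp, isHomogeneous_X _ i⟩

lemma isHomogeneous {N : ℕ} (h : HasTwiceDegree f w) (hw : w = 2 * N) : f.IsHomogeneous N := by
  rcases h with rfl | ⟨M, hM, h⟩
  · exact isHomogeneous_zero ..
  · obtain rfl : M = N := by omega
    exact h

lemma add (hf : HasTwiceDegree f w) (hg : HasTwiceDegree g w) : HasTwiceDegree (f + g) w := by
  rcases hf with rfl | ⟨N, hN, hf⟩
  · simpa
  · exact Or.inr ⟨N, hN, hf.add (hg.isHomogeneous hN.symm)⟩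

lemma neg (hf : HasTwiceDegree f w) : HasTwiceDegree (-f) w := by
  rcases hf with rfl | ⟨N, hN, hf⟩
  · simpa using zero w
  · exact Or.inr ⟨N, hN, hf.neg⟩

lemma sub (hf : HasTwiceDegree f w) (hg : HasTwiceDegree g w) : HasTwiceDegree (f - g) w := by
  rw [sub_eq_add_neg]; exact hf.add hg.neg

lemma mul (hf : HasTwiceDegree f v) (hg : HasTwiceDegree g w) : HasTwiceDegree (f * g) (v + w) := by
  rcases hf with rfl | ⟨N, hN, hf⟩
  · rw [zero_mul]; exact zero _
  rcases hg with rfl | ⟨M, hM, hg⟩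
  · rw [mul_zero]; exact zero _
  exact Or.inr ⟨N + M, by push_cast; omega, hf.mul hg⟩

lemma sum {ι : Type*} (s : Finset ι) {F : ι → MvPolynomial (Fin 3) ℂ}
    (h : ∀ i ∈ s, HasTwiceDegree (F i) w) : HasTwiceDegree (∑ i ∈ s, F i) w :=
  Finset.sum_induction _ (HasTwiceDegree · w) (fun _ _ => add) (zero w) h

lemma congr (h : HasTwiceDegree f v) (hvw : v = w) : HasTwiceDegree f w := hvw ▸ h

end HasTwiceDegree

/-- A homogeneous element of an ideal generated by finitely many homogeneous elements is a
combination of the generators with homogeneous coefficients of the expected degrees. -/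
lemma exists_homogeneous_coeffs {ι : Type*} [Fintype ι] {v : ι → MvPolynomial (Fin 3) ℂ}
    {w : ι → ℤ} (hv : ∀ i, HasTwiceDegree (v i) (w i)) {f : MvPolynomial (Fin 3) ℂ} {N : ℕ}
    (hf : f.IsHomogeneous N) (hmem : f ∈ Ideal.span (Set.range v)) :
    ∃ h : ι → MvPolynomial (Fin 3) ℂ,
      (∀ i, HasTwiceDegree (h i) (2 * N - w i)) ∧ f = ∑ i, h i * v i := by
  let : GradedAlgebra (homogeneousSubmodule (Fin 3) ℂ) := MvPolynomial.gradedAlgebra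
  obtain ⟨c, hc⟩ := (Submodule.mem_span_range_iff_exists_fun _).mp hmem
  have key : ∀ i, ∃ h, HasTwiceDegree h (2 * N - w i) ∧
      (DirectSum.decompose (homogeneousSubmodule (Fin 3) ℂ) (c i * v i) N :
        MvPolynomial (Fin 3) ℂ) = h * v i := by
    intro i
    rcases hv i with h0 | ⟨n, hn, hvn⟩
    · exact ⟨0, .zero _, by simp [h0]⟩
    · by_cases hnN : n ≤ N
      · refine ⟨DirectSum.decompose (homogeneousSubmodule (Fin 3) ℂ) (c i) (N - n), ?_,
          DirectSum.coe_decompose_mul_of_right_mem_of_le _ hvn hnN⟩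
        refine HasTwiceDegree.congr (.of_isHomogeneous ((mem_homogeneousSubmodule _ _).mp (SetLike.coe_mem _))) ?_
        push_cast [hnN]
        omega
      · exact ⟨0, .zero _, by
          rw [zero_mul]; exact DirectSum.coe_decompose_mul_of_right_mem_of_not_le _ hvn hnN⟩
  choose h hw hh using key
  refine ⟨h, hw, ?_⟩
  have hf' : (DirectSum.decompose (homogeneousSubmodule (Fin 3) ℂ) f N :
      MvPolynomial (Fin 3) ℂ) = f := DirectSum.decompose_of_mem_same _ hf
  rw [← hf', ← hc, ← GradedRing.proj_apply, map_sum]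
  exact Finset.sum_congr rfl fun i _ => hh i

lemma mul_mem_of_mem_span_range {ι R : Type*} [CommRing R] {v : ι → R} {c x : R} {J : Ideal R}
    (hv : ∀ i, c * v i ∈ J) (hx : x ∈ Ideal.span (Set.range v)) : c * x ∈ J := by
  induction hx using Submodule.span_induction with
  | mem x hx => obtain ⟨i, rfl⟩ := hx; exact hv i
  | zero => simp
  | add x y _ _ hx hy => rw [mul_add]; exact J.add_mem hx hy
  | smul a x _ hx => rw [smul_eq_mul, mul_left_comm]; exact J.mul_mem_left a hx

lemma mem_span_range_X {f : MvPolynomial (Fin 3) ℂ} {N : ℕ} (hf : f.IsHomogeneous (N + 1)) :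
    f ∈ Ideal.span (Set.range (X : Fin 3 → MvPolynomial (Fin 3) ℂ)) := by
  rw [← Set.image_univ, mem_ideal_span_X_image]
  intro m hm
  have := hf.degree_eq_sum_deg_support hm
  by_contra! h
  have : m = 0 := Finsupp.ext fun i => h i (Set.mem_univ i)
  simp_all

/-- An ideal containing all forms of degree `N` contains all forms of degree `N + 1`. -/
lemma forms_mem_succ {J : Ideal (MvPolynomial (Fin 3) ℂ)} {N : ℕ}
    (h : ∀ f : MvPolynomial (Fin 3) ℂ, f.IsHomogeneous N → f ∈ J)
    {f : MvPolynomial (Fin 3) ℂ} (hf : f.IsHomogeneous (N + 1)) : f ∈ J := by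
  obtain ⟨c, hc, rfl⟩ := exists_homogeneous_coeffs HasTwiceDegree.X hf (mem_span_range_X hf)
  exact J.sum_mem fun i _ => J.mul_mem_right _
    (h _ ((hc i).isHomogeneous (by push_cast; ring)))

/-- The linear form `x + t y + t² z`. -/
noncomputable def lineForm (t : ℂ) : MvPolynomial (Fin 3) ℂ :=
  X 0 + C t * X 1 + C (t ^ 2) * X 2

/-- The common zero of `lineForm t` and `lineForm t'`. -/
def linePoint (t t' : ℂ) : Fin 3 → ℂ := ![t * t', -(t + t'), 1]

lemma eval_lineForm (t t' a : ℂ) : eval (linePoint t t') (lineForm a) = (t - a) * (t' - a) := by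
  simp [lineForm, linePoint]; ring

lemma hasTwiceDegree_lineForm (t : ℂ) : HasTwiceDegree (lineForm t) 2 :=
  ((HasTwiceDegree.X 0).add (((HasTwiceDegree.C t).mul (.X 1)).congr (by simp))).add
    (((HasTwiceDegree.C _).mul (.X 2)).congr (by simp))

lemma lineForm_ne_zero (t : ℂ) : lineForm t ≠ 0 := by
  intro h
  have := eval_lineForm (t + 1) (t + 1) t
  simp [h] at this

lemma aeval_mul_of_isHomogeneous {f : MvPolynomial (Fin 3) ℂ} {N : ℕ} (hf : f.IsHomogeneous N)
    (p : Fin 3 → ℂ) (Z : MvPolynomial (Fin 3) ℂ) :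
    aeval (fun i => C (p i) * Z) f = C (eval p f) * Z ^ N := by
  rw [aeval_def, eval₂_eq', eval_eq', map_sum, Finset.sum_mul]
  refine Finset.sum_congr rfl fun m hm => ?_
  have hN := hf.degree_eq_sum_deg_support hm
  simp only [mul_pow, Finset.prod_mul_distrib, Finset.prod_pow_eq_pow_sum, map_mul, map_prod,
    map_pow, algebraMap_eq, mul_assoc]
  rw [hN, Finset.sum_subset (Finset.subset_univ m.support)
    fun i _ hi => Finsupp.notMem_support_iff.mp hi]

lemma sub_mem_span_lineForm {t t' : ℂ} (ht : t ≠ t') {f : MvPolynomial (Fin 3) ℂ} {N : ℕ}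
    (hf : f.IsHomogeneous N) :
    f - C (eval (linePoint t t') f) * X 2 ^ N ∈ Ideal.span {lineForm t, lineForm t'} := by
  rw [← aeval_mul_of_isHomogeneous hf, ← Ideal.Quotient.eq]
  set I := Ideal.span {lineForm t, lineForm t'} with hI
  have h : (Ideal.Quotient.mkₐ ℂ I).comp (aeval fun i => C (linePoint t t' i) * X 2) =
      Ideal.Quotient.mkₐ ℂ I := by
    refine algHom_ext fun i => ?_
    rw [AlgHom.comp_apply, aeval_X, Ideal.Quotient.mkₐ_eq_mk, Ideal.Quotient.eq,
      Ideal.mem_span_pair]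
    have hc : C (t - t')⁻¹ * (C t - C t') = (1 : MvPolynomial (Fin 3) ℂ) := by
      rw [← C_sub, ← C_mul, inv_mul_cancel₀ (sub_ne_zero.mpr ht), C_1]
    fin_cases i
    · refine ⟨C (t - t')⁻¹ * C t', -(C (t - t')⁻¹ * C t), ?_⟩
      simp only [lineForm, linePoint, Fin.zero_eta, Matrix.cons_val_zero, map_mul, map_pow]
      linear_combination (C t * C t' * X 2 - X 0) * hc
    · refine ⟨-C (t - t')⁻¹, C (t - t')⁻¹, ?_⟩
      simp only [lineForm, linePoint, Fin.mk_one, Matrix.cons_val_one, Matrix.cons_val_zero, map_neg,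
        map_add, map_pow]
      linear_combination (- (C t + C t') * X 2 - X 1) * hc
    · exact ⟨0, 0, by simp [linePoint]⟩
  exact (DFunLike.congr_fun h f).symm

/-- Two lines and a form of degree at most `N` not vanishing at their common point generate an
ideal containing all forms of degree `N`. -/
lemma mem_span_lineForm_of_eval_ne_zero {t t' : ℂ} (ht : t ≠ t') {q : MvPolynomial (Fin 3) ℂ}
    {n N : ℕ} (hq : q.IsHomogeneous n) (hqe : eval (linePoint t t') q ≠ 0) (hn : n ≤ N)
    {f : MvPolynomial (Fin 3) ℂ} (hf : f.IsHomogeneous N) :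
    f ∈ Ideal.span (Set.range ![lineForm t, lineForm t', q]) := by
  have hle : Ideal.span {lineForm t, lineForm t'} ≤
      Ideal.span (Set.range ![lineForm t, lineForm t', q]) := by
    refine Ideal.span_mono ?_
    rintro x (rfl | rfl)
    · exact ⟨0, rfl⟩
    · exact ⟨1, rfl⟩
  have h1 := hle (sub_mem_span_lineForm ht hf)
  have h2 := hle (sub_mem_span_lineForm ht hq)
  have h3 : q ∈ Ideal.span (Set.range ![lineForm t, lineForm t', q]) :=
    Ideal.subset_span ⟨2, rfl⟩
  have h4 := (Submodule.sub_mem_iff_right _ h3).mp h2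
  have h5 : (X 2 ^ N : MvPolynomial (Fin 3) ℂ) = C (eval (linePoint t t') q)⁻¹ * X 2 ^ (N - n) *
      (C (eval (linePoint t t') q) * X 2 ^ n) := by
    have : C (eval (linePoint t t') q)⁻¹ * C (eval (linePoint t t') q) =
        (1 : MvPolynomial (Fin 3) ℂ) := by rw [← C_mul, inv_mul_cancel₀ hqe, C_1]
    conv_lhs => rw [← Nat.sub_add_cancel hn, pow_add]
    linear_combination (- X 2 ^ (N - n) * X 2 ^ n) * this
  refine (Submodule.sub_mem_iff_left _ ?_).mp h1
  rw [h5]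
  exact Ideal.mul_mem_left _ _ (Ideal.mul_mem_left _ _ h4)

end Forms

section Raise

open Filter

/-- A skew-symmetric matrix of forms with entries of degree `(a i + a j) / 2` whose submaximal
Pfaffians span all forms of degree `d`, together with the genericity conditions which make
it possible to raise the degrees `a i`. -/
structure IsSpanning {n : ℕ} (G : Matrix (Fin (2*n)) (Fin (2*n)) (MvPolynomial (Fin 3) ℂ))
    (a : Fin (2*n) → ℤ) (d : ℕ) : Prop where
  skew : IsSkew G
  entry_degree : ∀ i j, HasTwiceDegree (G i j) (a i + a j)
  neg_one_le : ∀ i, -1 ≤ a i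
  subPf_degree : ∀ i j, HasTwiceDegree (subPf G i j) (2 * d - a i - a j)
  full : ∀ f : MvPolynomial (Fin 3) ℂ, f.IsHomogeneous d →
    f ∈ Ideal.span (Set.range fun p : Fin (2*n) × Fin (2*n) => subPf G p.1 p.2)
  line : ∀ i, ∀ᶠ t in cofinite, ∀ f : MvPolynomial (Fin 3) ℂ, f.IsHomogeneous (d + 1) →
    f ∈ Ideal.span (Set.range fun o : Option (Fin (2*n)) => o.elim (lineForm t) (subPf G i))
  point : ∀ i j, i ≠ j → ∀ᶠ t in cofinite, ∀ᶠ t' in cofinite,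
    eval (linePoint t t') (subPf G i j) ≠ 0

variable {n : ℕ} {G : Matrix (Fin (2*n)) (Fin (2*n)) (MvPolynomial (Fin 3) ℂ)}
  {a : Fin (2*n) → ℤ} {d : ℕ}

lemma IsSpanning.raise (h : IsSpanning G a d) (i : Fin (2*n)) :
    ∃ G', IsSpanning (n := n) G' (Function.update a i (a i + 2)) (d + 1) := by
  obtain ⟨t, hfull, hpt⟩ := ((h.line i).and (eventually_all.mpr fun i' =>
    eventually_all.mpr fun hi' : i' ≠ i => h.point i' i hi')).exists
  have hL := lineForm_ne_zero t
  set L := lineForm t with hLdef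
  have hl := subPf_scaleAt_left hL i G
  have hr := subPf_scaleAt_right hL i G
  have hne := fun {a b} => subPf_scaleAt_of_ne L (i := i) G (a := a) (b := b)
  have hmulJ : ∀ p : Fin (2*n) × Fin (2*n), L * subPf G p.1 p.2 ∈
      Ideal.span (Set.range fun p : Fin (2*n) × Fin (2*n) => subPf (scaleAt L i G) p.1 p.2) := by
    rintro ⟨b, c⟩
    by_cases hb : b = i
    · subst hb
      rw [← hl]
      exact Ideal.mul_mem_left _ _ (Ideal.subset_span ⟨(b, c), rfl⟩)
    by_cases hc : c = i
    · subst hc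
      rw [← hr]
      exact Ideal.mul_mem_left _ _ (Ideal.subset_span ⟨(b, c), rfl⟩)
    rw [← hne hb hc]
    exact Ideal.subset_span ⟨(b, c), rfl⟩
  refine ⟨scaleAt L i G, ?_, ?_, ?_, ?_, ?_, ?_, ?_⟩
  · intro b c
    rw [scaleAt_apply, scaleAt_apply, h.skew b c]
    ring
  · intro b c
    have hD : ∀ b, HasTwiceDegree (if b = i then L else 1)
        (Function.update a i (a i + 2) b - a b) := by
      intro b
      by_cases hb : b = i
      · subst hb
        simpa using hasTwiceDegree_lineForm t
      · simpa [hb] using HasTwiceDegree.one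
    rw [scaleAt_apply]
    exact (((hD b).mul (h.entry_degree b c)).mul (hD c)).congr (by ring)
  · intro b
    rw [Function.update_apply]
    have := h.neg_one_le b
    have := h.neg_one_le i
    split_ifs <;> omega
  · intro b c
    by_cases hb : b = i
    · subst hb
      rw [hl]
      by_cases hc : c = b
      · rw [hc, subPf_self]; exact .zero _
      · rw [Function.update_self, Function.update_of_ne hc]
        exact (h.subPf_degree b c).congr (by push_cast; ring)
    by_cases hc : c = i
    · subst hc
      rw [hr, Function.update_self, Function.update_of_ne hb]
      exact (h.subPf_degree b c).congr (by push_cast; ring)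
    rw [hne hb hc, Function.update_of_ne hb, Function.update_of_ne hc]
    exact ((hasTwiceDegree_lineForm t).mul (h.subPf_degree b c)).congr (by push_cast; ring)
  · intro f hf
    obtain ⟨c, hc, rfl⟩ := exists_homogeneous_coeffs
      (w := fun o => o.elim 2 fun j => 2 * d - a i - a j)
      (by rintro (_ | j); exacts [hasTwiceDegree_lineForm t, h.subPf_degree i j]) hf (hfull f hf)
    rw [Fintype.sum_option]
    refine Ideal.add_mem _ ?_ (Ideal.sum_mem _ fun j _ => Ideal.mul_mem_left _ _ ?_)
    · rw [mul_comm (c none)]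
      refine mul_mem_of_mem_span_range hmulJ (h.full _ ((hc none).isHomogeneous ?_))
      simp only [Option.elim]
      push_cast
      ring
    · exact Ideal.subset_span ⟨(i, j), hl j⟩
  · intro i'
    by_cases hi' : i' = i
    · subst hi'
      refine (h.line i').mono fun t'' ht'' f hf => ?_
      have : (fun o : Option (Fin (2*n)) => o.elim (lineForm t'') (subPf (scaleAt L i' G) i')) =
          fun o => o.elim (lineForm t'') (subPf G i') := by
        rw [show subPf (scaleAt L i' G) i' = subPf G i' from funext hl]
      rw [this]
      exact forms_mem_succ ht'' hf
    · filter_upwards [h.line i', hpt i' hi', (Set.finite_singleton t).compl_mem_cofinite]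
        with t'' h1 h2 h3 f hf
      have hmem : ∀ j, subPf (scaleAt L i G) i' j ∈ Ideal.span (Set.range
          fun o : Option (Fin (2*n)) => o.elim (lineForm t'') (subPf (scaleAt L i G) i')) :=
        fun j => Ideal.subset_span ⟨some j, rfl⟩
      have hmem' : lineForm t'' ∈ Ideal.span (Set.range
          fun o : Option (Fin (2*n)) => o.elim (lineForm t'') (subPf (scaleAt L i G) i')) :=
        Ideal.subset_span ⟨none, rfl⟩
      obtain h0 | ⟨m, hm, hq⟩ := h.subPf_degree i' i
      · simp [h0] at h2
      have hmd : m ≤ d + 1 + 1 := by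
        have := h.neg_one_le i
        have := h.neg_one_le i'
        omega
      obtain ⟨c, hc, rfl⟩ := exists_homogeneous_coeffs (w := ![2, 2, 2 * m])
        (by
          intro j
          fin_cases j
          exacts [hasTwiceDegree_lineForm t, hasTwiceDegree_lineForm t'', .of_isHomogeneous hq])
        hf (mem_span_lineForm_of_eval_ne_zero (fun h => h3 h.symm) hq h2 hmd hf)
      rw [Fin.sum_univ_three]
      refine Ideal.add_mem _ (Ideal.add_mem _ ?_ ?_) ?_
      · change c 0 * L ∈ _
        rw [mul_comm (c 0)]
        refine mul_mem_of_mem_span_range ?_ (h1 _ ((hc 0).isHomogeneous ?_))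
        · rintro (_ | j)
          · exact Ideal.mul_mem_left _ _ hmem'
          · by_cases hj : j = i
            · subst hj
              simp only [Option.elim]
              rw [← hr]
              exact Ideal.mul_mem_left _ _ (hmem j)
            · simp only [Option.elim]
              rw [← hne hi' hj]
              exact hmem j
        · simp
          ring
      · exact Ideal.mul_mem_left _ _ hmem'
      · change c 2 * subPf G i' i ∈ _
        rw [← hr]
        exact Ideal.mul_mem_left _ _ (hmem i)
  · intro b c hbc
    by_cases hb : b = i
    · subst hb; rw [hl]; exact h.point _ _ hbc
    by_cases hc : c = i
    · subst hc; rw [hr]; exact h.point _ _ hbc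
    rw [hne hb hc]
    filter_upwards [h.point b c hbc, (Set.finite_singleton t).compl_mem_cofinite] with t1 h1 h1'
    filter_upwards [h1, (Set.finite_singleton t).compl_mem_cofinite] with t2 h2 h2'
    rw [map_mul, hLdef, eval_lineForm]
    exact mul_ne_zero (mul_ne_zero (sub_ne_zero.mpr h1') (sub_ne_zero.mpr h2')) h2

end Raise

lemma isSkew_stdSympl (S : Type*) [CommRing S] (n : ℕ) : IsSkew (stdSympl S n) := by
  intro i j
  simp only [stdSympl, eq_comm (a := j.1 / 2)]
  split_ifs <;> simp

lemma subPf_stdSympl {S : Type*} [CommRing S] [Algebra ℂ S] [IsDomain S] [CharZero S] {n : ℕ}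
    (i j : Fin (2*n)) :
    subPf (stdSympl S n) i j = pf (stdSympl S n) * stdSympl S n i j := by
  by_cases hij : i.1 / 2 = j.1 / 2
  · obtain h | h | h : i = j ∨ (i.1 % 2 = 0 ∧ j.1 = i.1 + 1) ∨ (j.1 % 2 = 0 ∧ i.1 = j.1 + 1) := by
      rw [Fin.ext_iff]; omega
    · rw [h, subPf_self]; simp [stdSympl]
    · rw [subPf_stdSympl_pair h.1 h.2, stdSympl, if_pos hij, h.2]; simp
    · rw [subPf_swap, subPf_stdSympl_pair h.1 h.2, stdSympl, if_pos hij, h.2]; simp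
  · rw [subPf_stdSympl_of_ne hij, stdSympl, if_neg hij, mul_zero]

section Base

variable {S : Type*} [CommRing S] [Algebra ℂ S] {n : ℕ}

/-- The standard symplectic matrix with its first row and column scaled by `P`, after the base
change whose matrix has the entries of `m` and `v` with index at least two in its first two
rows. -/
def baseMat (hn : 0 < n) (P : S) (m v : Fin (2*n) → S) : Matrix (Fin (2*n)) (Fin (2*n)) S :=
  let U := unipotent hn (fun j => if j.1 < 2 then 0 else m j) fun j => if j.1 < 2 then 0 else v j
  U * scaleAt P ⟨0, by omega⟩ (stdSympl S n) * U.transpose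

lemma subPf_baseMat [IsDomain S] [CharZero S] (hn : 0 < n) {P : S} (hP : P ≠ 0)
    {m v : Fin (2*n) → S} (hm0 : m ⟨0, by omega⟩ = 1) (hm1 : m ⟨1, by omega⟩ = 0)
    (hv0 : v ⟨0, by omega⟩ = 0) (hv1 : v ⟨1, by omega⟩ = 1) (i j : Fin (2*n)) :
    subPf (baseMat hn P m v) i j = pf (stdSympl S n) *
      ((if i.1 < 2 then 0 else P * stdSympl S n i j) + m i * v j - v i * m j) := by
  have hT : ∀ a b, subPf (scaleAt P ⟨0, by omega⟩ (stdSympl S n)) a b = pf (stdSympl S n) *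
      (if a.1 = 0 ∨ b.1 = 0 then stdSympl S n a b else P * stdSympl S n a b) := by
    intro a b
    by_cases ha : a = ⟨0, by omega⟩
    · subst ha; rw [subPf_scaleAt_left hP, subPf_stdSympl, if_pos (Or.inl rfl)]
    by_cases hb : b = ⟨0, by omega⟩
    · subst hb; rw [subPf_scaleAt_right hP, subPf_stdSympl, if_pos (Or.inr rfl)]
    rw [subPf_scaleAt_of_ne P _ ha hb, subPf_stdSympl, if_neg]
    · ring
    · rintro (h | h)
      · exact ha (Fin.ext h)
      · exact hb (Fin.ext h)
  rw [baseMat, subPf_unipotent hn (fun j hj => if_pos hj) (fun j hj => if_pos hj)]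
  simp only [hT]
  have hlt : ∀ i : Fin (2*n), i = ⟨0, by omega⟩ ∨ i = ⟨1, by omega⟩ ∨ 2 ≤ i.1 := by
    intro i; simp only [Fin.ext_iff]; omega
  have h2 : ∀ {i : Fin (2*n)}, 2 ≤ i.1 → ¬ i.1 / 2 = 0 ∧ ¬ i.1 < 2 ∧ ¬ i.1 = 0 ∧ ¬ 0 = i.1 / 2 := by
    intro i hi; omega
  rcases hlt i with rfl | rfl | hi <;> rcases hlt j with rfl | rfl | hj
  · simp [stdSympl, hm0, hv0]
  · simp [stdSympl, hm0, hm1, hv0, hv1]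
  · obtain ⟨k1, k2, k3, k4⟩ := h2 hj
    simp [stdSympl, hm0, hv0, k1, k2, k3, k4]
    ring
  · simp [stdSympl, hm0, hm1, hv0, hv1]
  · simp [stdSympl, hm1, hv1]
  · obtain ⟨k1, k2, k3, k4⟩ := h2 hj
    simp [stdSympl, hm1, hv1, k1, k2, k3, k4]
    ring
  · obtain ⟨k1, k2, k3, -⟩ := h2 hi
    simp [stdSympl, hm0, hv0, k1, k2, k3]
    ring
  · obtain ⟨k1, k2, k3, -⟩ := h2 hi
    simp [stdSympl, hm1, hv1, k1, k2, k3]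
    ring
  · obtain ⟨k1, k2, k3, -⟩ := h2 hi
    obtain ⟨l1, l2, l3, -⟩ := h2 hj
    simp [stdSympl, k1, k2, k3, l1, l2, l3]
    split_ifs <;> ring

omit [Algebra ℂ S] in
lemma isSkew_baseMat (hn : 0 < n) (P : S) (m v : Fin (2*n) → S) : IsSkew (baseMat hn P m v) := by
  have h : (scaleAt P ⟨0, by omega⟩ (stdSympl S n)).transpose =
      -scaleAt P ⟨0, by omega⟩ (stdSympl S n) := by
    ext i j
    rw [Matrix.transpose_apply, Matrix.neg_apply, scaleAt_apply, scaleAt_apply,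
      isSkew_stdSympl S n i j]
    ring
  intro i j
  have : (baseMat hn P m v).transpose = -baseMat hn P m v := by
    simp only [baseMat, Matrix.transpose_mul, Matrix.transpose_transpose, h, Matrix.mul_neg,
      Matrix.neg_mul, Matrix.mul_assoc]
  exact congrFun (congrFun this i) j

end Base

section BaseForms

open Filter

variable {n : ℕ}

/-- The entries of the first row of the base change. -/
noncomputable def baseFst (n : ℕ) (Y : MvPolynomial (Fin 3) ℂ) (j : Fin (2*n)) :
    MvPolynomial (Fin 3) ℂ :=
  if j.1 % 2 = 0 then 1 else if j.1 = 1 then 0 else Y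

/-- The entries of the second row of the base change. -/
noncomputable def baseSnd (n : ℕ) (Y Z : MvPolynomial (Fin 3) ℂ) (j : Fin (2*n)) :
    MvPolynomial (Fin 3) ℂ :=
  if j.1 % 2 = 0 then C (j.1 : ℂ) else if j.1 = 1 then 1 else Z + C (j.1 : ℂ) * Y

/-- The diagonal degrees of the base matrix. -/
def baseDeg (n : ℕ) (α : ℕ) (j : Fin (2*n)) : ℤ :=
  if j.1 % 2 = 0 then α else if j.1 = 1 then α else -α

lemma hasTwiceDegree_baseFst {α : ℕ} {Y : MvPolynomial (Fin 3) ℂ}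
    (hY : HasTwiceDegree Y (2 * α)) (j : Fin (2*n)) :
    HasTwiceDegree (baseFst n Y j) (α - baseDeg n α j) := by
  unfold baseFst baseDeg
  split_ifs
  · simpa using HasTwiceDegree.one
  · exact .zero _
  · exact hY.congr (by ring)

lemma hasTwiceDegree_baseSnd {α : ℕ} {Y Z : MvPolynomial (Fin 3) ℂ}
    (hY : HasTwiceDegree Y (2 * α)) (hZ : HasTwiceDegree Z (2 * α)) (j : Fin (2*n)) :
    HasTwiceDegree (baseSnd n Y Z j) (α - baseDeg n α j) := by
  unfold baseSnd baseDeg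
  split_ifs
  · exact (HasTwiceDegree.C _).congr (by simp)
  · simpa using HasTwiceDegree.one
  · exact (hZ.add (((HasTwiceDegree.C _).mul hY).congr (zero_add _))).congr (by ring)

lemma hasTwiceDegree_unipotent_base {α : ℕ} {Y Z : MvPolynomial (Fin 3) ℂ}
    (hY : HasTwiceDegree Y (2 * α)) (hZ : HasTwiceDegree Z (2 * α)) (hn : 0 < n)
    (i j : Fin (2*n)) :
    HasTwiceDegree (unipotent hn (fun j => if j.1 < 2 then 0 else baseFst n Y j)
      (fun j => if j.1 < 2 then 0 else baseSnd n Y Z j) i j)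
      (baseDeg n α i - baseDeg n α j) := by
  simp only [unipotent, Matrix.sub_apply, Matrix.vecMulVec_apply, Pi.single_apply, Fin.ext_iff,
    Matrix.one_apply]
  refine ((?_ : HasTwiceDegree _ _).sub ?_).sub ?_
  · split_ifs with h
    · rw [Fin.ext h]; simpa using HasTwiceDegree.one
    · exact .zero _
  · split_ifs with h h'
    · simpa using HasTwiceDegree.zero _
    · rw [one_mul]; exact (hasTwiceDegree_baseFst hY j).congr (by simp [baseDeg, h])
    · simpa using HasTwiceDegree.zero _
    · simpa using HasTwiceDegree.zero _
  · split_ifs with h h'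
    · simpa using HasTwiceDegree.zero _
    · rw [one_mul]; exact (hasTwiceDegree_baseSnd hY hZ j).congr (by simp [baseDeg, h])
    · simpa using HasTwiceDegree.zero _
    · simpa using HasTwiceDegree.zero _

lemma hasTwiceDegree_scaleAt_stdSympl {α : ℕ} {P : MvPolynomial (Fin 3) ℂ}
    (hP : HasTwiceDegree P (2 * α)) (hn : 0 < n) (i j : Fin (2*n)) :
    HasTwiceDegree (scaleAt P ⟨0, by omega⟩ (stdSympl _ n) i j)
      (baseDeg n α i + baseDeg n α j) := by
  rw [scaleAt_apply, stdSympl]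
  by_cases hij : i.1 / 2 = j.1 / 2
  swap
  · simpa [hij] using HasTwiceDegree.zero _
  by_cases hne : i = j
  · simpa [hne] using HasTwiceDegree.zero _
  have hne' := Fin.val_ne_of_ne hne
  have hc : HasTwiceDegree (((j.1 : ℤ) - (i.1 : ℤ) : ℤ) : MvPolynomial (Fin 3) ℂ) 0 := by
    rw [← map_intCast (C : ℂ →+* MvPolynomial (Fin 3) ℂ)]; exact .C _
  simp only [if_pos hij, Fin.ext_iff]
  by_cases hi : i.1 = 0
  · have hj : j.1 = 1 := by omega
    rw [if_pos hi, if_neg (by omega), mul_one]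
    exact (hP.mul hc).congr (by simp [baseDeg, hi, hj]; ring)
  by_cases hj : j.1 = 0
  · have hi : i.1 = 1 := by omega
    rw [if_pos hj, if_neg (by omega), one_mul]
    exact (hc.mul hP).congr (by simp [baseDeg, hi, hj]; ring)
  rw [if_neg hi, if_neg hj, one_mul, mul_one]
  refine hc.congr ?_
  unfold baseDeg
  split_ifs <;> omega

lemma hasTwiceDegree_baseMat {α : ℕ} {P Y Z : MvPolynomial (Fin 3) ℂ}
    (hP : HasTwiceDegree P (2 * α)) (hY : HasTwiceDegree Y (2 * α))
    (hZ : HasTwiceDegree Z (2 * α)) (hn : 0 < n) (i j : Fin (2*n)) :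
    HasTwiceDegree (baseMat hn P (baseFst n Y) (baseSnd n Y Z) i j)
      (baseDeg n α i + baseDeg n α j) := by
  rw [baseMat, Matrix.mul_apply]
  refine .sum _ fun b _ => ?_
  rw [Matrix.mul_apply, Finset.sum_mul]
  refine .sum _ fun a _ => ?_
  exact (((hasTwiceDegree_unipotent_base hY hZ hn i a).mul
    (hasTwiceDegree_scaleAt_stdSympl hP hn a b)).mul
    (hasTwiceDegree_unipotent_base hY hZ hn j b)).congr (by ring)

lemma pf_stdSympl_eq_C (n : ℕ) :
    pf (stdSympl (MvPolynomial (Fin 3) ℂ) n) = C (pf (stdSympl ℂ n)) := by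
  rw [← stdSympl_map (algebraMap ℂ (MvPolynomial (Fin 3) ℂ))]
  exact pf_map (Algebra.ofId ℂ (MvPolynomial (Fin 3) ℂ)) _

lemma isSpanning_base {α : ℕ} (hα : α ≤ 1) {P Y Z : MvPolynomial (Fin 3) ℂ} (hP0 : P ≠ 0)
    (hP : HasTwiceDegree P (2 * α)) (hY : HasTwiceDegree Y (2 * α))
    (hZ : HasTwiceDegree Z (2 * α))
    (hmem : ∀ (J : Ideal (MvPolynomial (Fin 3) ℂ)) (t : ℂ), Y ∈ J → Z ∈ J → lineForm t ∈ J →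
      ∀ f : MvPolynomial (Fin 3) ℂ, f.IsHomogeneous (α + 1) → f ∈ J)
    (hYe : ∀ᶠ t in cofinite, ∀ᶠ t' in cofinite, eval (linePoint t t') Y ≠ 0)
    (hYZe : ∀ c : ℂ, c ≠ 0 → ∀ᶠ t in cofinite, ∀ᶠ t' in cofinite,
      eval (linePoint t t') (Z + C c * Y) ≠ 0)
    (hPYZe : ∀ᶠ t in cofinite, ∀ᶠ t' in cofinite, eval (linePoint t t') (Z + Y + P) ≠ 0)
    (hn : 0 < n) :
    IsSpanning (baseMat hn P (baseFst n Y) (baseSnd n Y Z)) (baseDeg n α) α := by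
  set G := baseMat hn P (baseFst n Y) (baseSnd n Y Z) with hG
  let i0 : Fin (2*n) := ⟨0, by omega⟩
  let i1 : Fin (2*n) := ⟨1, by omega⟩
  have hc0 := pf_stdSympl_ne_zero n
  have hq : ∀ i j, subPf G i j = C (pf (stdSympl ℂ n)) *
      ((if i.1 < 2 then 0 else P * stdSympl _ n i j) +
        baseFst n Y i * baseSnd n Y Z j - baseSnd n Y Z i * baseFst n Y j) := by
    intro i j
    rw [hG, subPf_baseMat hn hP0 (by simp [baseFst]) (by simp [baseFst]) (by simp [baseSnd])
      (by simp [baseSnd]), pf_stdSympl_eq_C]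
  have hcancel : ∀ (J : Ideal (MvPolynomial (Fin 3) ℂ)) (g : MvPolynomial (Fin 3) ℂ),
      C (pf (stdSympl ℂ n)) * g ∈ J → g ∈ J := by
    intro J g hg
    have := J.mul_mem_left (C (pf (stdSympl ℂ n))⁻¹) hg
    rwa [← mul_assoc, ← C_mul, inv_mul_cancel₀ hc0, C_1, one_mul] at this
  have hcases : ∀ i : Fin (2*n), i.1 % 2 = 0 ∨ i = i1 ∨ (i.1 % 2 = 1 ∧ 3 ≤ i.1) := by
    intro i; simp only [i1, Fin.ext_iff]; omega
  have hmi1 : baseFst n Y i1 = 0 := by simp [baseFst, i1]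
  have hvi1 : baseSnd n Y Z i1 = 1 := by simp [baseSnd, i1]
  have hme : ∀ {i : Fin (2*n)}, i.1 % 2 = 0 → baseFst n Y i = 1 := fun h => if_pos h
  have hve : ∀ {i : Fin (2*n)}, i.1 % 2 = 0 → baseSnd n Y Z i = C (i.1 : ℂ) := fun h => if_pos h
  have hmo : ∀ {i : Fin (2*n)}, i.1 % 2 = 1 ∧ 3 ≤ i.1 → baseFst n Y i = Y := fun h => by
    rw [baseFst, if_neg (by omega), if_neg (by omega)]
  have hvo : ∀ {i : Fin (2*n)}, i.1 % 2 = 1 ∧ 3 ≤ i.1 →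
      baseSnd n Y Z i = Z + C (i.1 : ℂ) * Y := fun h => by
    rw [baseSnd, if_neg (by omega), if_neg (by omega)]
  have hE : ∀ {i j : Fin (2*n)}, (i.1 < 2 ∨ i.1 / 2 ≠ j.1 / 2) →
      (if i.1 < 2 then 0 else P * stdSympl _ n i j) = 0 := by
    intro i j h
    by_cases hi : i.1 < 2
    · rw [if_pos hi]
    · rw [if_neg hi, stdSympl, if_neg (h.resolve_left hi), mul_zero]
  refine ⟨isSkew_baseMat hn P _ _, hasTwiceDegree_baseMat hP hY hZ hn, ?_, ?_, ?_, ?_, ?_⟩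
  · intro i
    unfold baseDeg
    split_ifs <;> omega
  · intro i j
    rw [hq]
    refine ((HasTwiceDegree.C _).mul (.sub (.add ?_ ((hasTwiceDegree_baseFst hY i).mul
      (hasTwiceDegree_baseSnd hY hZ j))) (((hasTwiceDegree_baseSnd hY hZ i).mul
      (hasTwiceDegree_baseFst hY j)).congr ?_))).congr (v := 0 + (α - baseDeg n α i +
        (α - baseDeg n α j))) (by ring)
    · split_ifs with hi
      · exact .zero _
      · have h := hasTwiceDegree_scaleAt_stdSympl HasTwiceDegree.one (α := 0) hn i j
        by_cases hij : i.1 / 2 = j.1 / 2 ∧ i ≠ j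
        · have hne := Fin.val_ne_of_ne hij.2
          rw [scaleAt_apply] at h
          have h' : HasTwiceDegree (stdSympl (MvPolynomial (Fin 3) ℂ) n i j) 0 :=
            (by simpa using h : HasTwiceDegree (stdSympl (MvPolynomial (Fin 3) ℂ) n i j) _).congr
              (by simp [baseDeg])
          refine (hP.mul h').congr ?_
          unfold baseDeg
          split_ifs <;> omega
        · have : stdSympl (MvPolynomial (Fin 3) ℂ) n i j = 0 := by
            rw [stdSympl]
            split_ifs with h1
            · have : i = j := by by_contra h2; exact hij ⟨h1, h2⟩
              simp [this]
            · rfl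
          rw [this, mul_zero]; exact .zero _
    · ring
  · intro f _
    have h1 : (1 : MvPolynomial (Fin 3) ℂ) ∈
        Ideal.span (Set.range fun p : Fin (2*n) × Fin (2*n) => subPf G p.1 p.2) := by
      refine hcancel _ _ (Ideal.subset_span ⟨(i0, i1), ?_⟩)
      simp only [hq, hE (Or.inl (show i0.1 < 2 by simp [i0])), hmi1, hvi1,
        hme (show i0.1 % 2 = 0 by simp [i0])]
      ring
    simpa using Ideal.mul_mem_left _ f h1
  · intro i
    refine Eventually.of_forall fun t f hf => ?_
    set J := Ideal.span (Set.range fun o : Option (Fin (2*n)) => o.elim (lineForm t) (subPf G i))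
    have hJ : ∀ j, ((if i.1 < 2 then 0 else P * stdSympl _ n i j) +
        baseFst n Y i * baseSnd n Y Z j - baseSnd n Y Z i * baseFst n Y j) ∈ J := fun j =>
      hcancel _ _ (Ideal.subset_span ⟨some j, hq i j⟩)
    have h0 := hJ i0
    have h1 := hJ i1
    rw [hme (show i0.1 % 2 = 0 by simp [i0]), hve (show i0.1 % 2 = 0 by simp [i0])] at h0
    rw [hmi1, hvi1] at h1
    rcases hcases i with hi | hi | hi
    · rw [hE (by simp only [i1]; omega), hme hi] at h1
      simpa using Ideal.mul_mem_left _ f h1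
    · subst hi
      rw [hE (by simp [i1]), hmi1, hvi1] at h0
      simpa using Ideal.mul_mem_left _ f h0
    · rw [hE (by simp only [i1]; omega), hmo hi] at h1
      rw [hE (by simp only [i0]; omega), hmo hi, hvo hi] at h0
      have hYJ : Y ∈ J := by simpa using h1
      refine hmem J t hYJ ?_ (Ideal.subset_span ⟨none, rfl⟩) f hf
      have := J.sub_mem (J.neg_mem h0) (J.mul_mem_left (C (i.1 : ℂ)) hYJ)
      convert this using 1
      simp [i0]
  · suffices H : ∀ i j : Fin (2*n), i.1 < j.1 → ∀ᶠ t in cofinite, ∀ᶠ t' in cofinite,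
        eval (linePoint t t') (subPf G i j) ≠ 0 by
      intro i j hij
      rcases lt_or_gt_of_ne (Fin.val_ne_of_ne hij) with h | h
      · exact H i j h
      · simpa [subPf_swap G i j] using H j i h
    intro i j hij
    have hcast : ∀ i j : Fin (2*n), i.1 ≠ j.1 → (i.1 : ℂ) - j.1 ≠ 0 := fun i j h =>
      sub_ne_zero.mpr (Nat.cast_injective.ne h)
    rw [hq]
    suffices H : ∃ (K : MvPolynomial (Fin 3) ℂ), (∀ᶠ t in cofinite, ∀ᶠ t' in cofinite,
        eval (linePoint t t') K ≠ 0) ∧ ((if i.1 < 2 then 0 else P * stdSympl _ n i j) +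
        baseFst n Y i * baseSnd n Y Z j - baseSnd n Y Z i * baseFst n Y j = K ∨
        (if i.1 < 2 then 0 else P * stdSympl _ n i j) +
        baseFst n Y i * baseSnd n Y Z j - baseSnd n Y Z i * baseFst n Y j = -K) by
      obtain ⟨K, hK, hK'⟩ := H
      refine hK.mono fun t ht => ht.mono fun t' ht' => ?_
      rcases hK' with h | h <;> rw [h] <;> simp [hc0, ht']
    have hconst : ∀ c : ℂ, c ≠ 0 → ∀ᶠ t in cofinite, ∀ᶠ t' in cofinite,
        eval (linePoint t t') (C c) ≠ 0 := fun c hc =>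
      Eventually.of_forall fun t => Eventually.of_forall fun t' => by simpa using hc
    rcases hcases i with hi | hi | hi <;> rcases hcases j with hj | hj | hj
    · refine ⟨_, hconst _ (hcast j i hij.ne'), Or.inl ?_⟩
      rw [hE (by omega), hme hi, hve hj, hve hi, hme hj, C_sub]
      ring
    · subst hj
      refine ⟨_, hconst 1 one_ne_zero, Or.inl ?_⟩
      rw [hE (by simp only [i1] at hij; omega), hme hi, hve hi, hmi1, hvi1, C_1]
      ring
    · by_cases hij' : j.1 = i.1 + 1
      · refine ⟨_, hPYZe, Or.inl ?_⟩
        rw [if_neg (by omega), stdSympl, if_pos (by omega), hme hi, hve hi, hmo hj, hvo hj, hij']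
        push_cast
        simp
        ring
      · refine ⟨_, hYZe _ (hcast j i hij.ne'), Or.inl ?_⟩
        rw [hE (by omega), hme hi, hve hi, hmo hj, hvo hj, C_sub]
        ring
    · subst hi
      refine ⟨_, hconst 1 one_ne_zero, Or.inr ?_⟩
      rw [hE (by simp [i1]), hmi1, hvi1, hme hj, C_1]
      ring
    · subst hi hj
      exact absurd hij (lt_irrefl _)
    · subst hi
      refine ⟨_, hYe, Or.inr ?_⟩
      rw [hE (by simp [i1]), hmi1, hvi1, hmo hj]
      ring
    · refine ⟨_, hYZe _ (hcast i j hij.ne), Or.inr ?_⟩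
      rw [hE (by omega), hmo hi, hvo hi, hve hj, hme hj, C_sub]
      ring
    · subst hj
      simp only [i1] at hij
      omega
    · refine ⟨C ((j.1 : ℂ) - i.1) * (Y * Y), ?_, Or.inl ?_⟩
      · refine hYe.mono fun t ht => ht.mono fun t' ht' => ?_
        simpa [ht'] using hcast j i hij.ne'
      · rw [hE (by omega), hmo hi, hvo hi, hvo hj, hmo hj, C_sub]
        ring

lemma eventually_affine_ne_zero {a b : ℂ} (h : a ≠ 0 ∨ b ≠ 0) :
    ∀ᶠ t in cofinite, a + b * t ≠ 0 := by
  by_cases hb : b = 0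
  · have ha := h.resolve_right (not_not.mpr hb)
    exact Eventually.of_forall fun t => by simpa [hb] using ha
  · filter_upwards [(Set.finite_singleton (-a / b)).compl_mem_cofinite] with t ht h0
    refine ht ?_
    rw [Set.mem_singleton_iff, eq_div_iff hb]
    linear_combination h0

/-- Spanning matrices with the smallest degrees of either parity. -/
lemma exists_isSpanning_base (hn : 0 < n) {α : ℕ} (hα : α ≤ 1) :
    ∃ G, IsSpanning G (baseDeg n α) α := by
  obtain rfl | rfl : α = 0 ∨ α = 1 := by omega
  · refine ⟨_, isSpanning_base hα (P := 1) (Y := 1) (Z := 0) one_ne_zero (by simpa using .one)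
      (by simpa using .one) (.zero _) ?_ ?_ ?_ ?_ hn⟩
    · intro J t hJ _ _ f _
      simpa using J.mul_mem_left f hJ
    · simp
    · intro c hc; simp [hc]
    · simp [one_add_one_eq_two]
  · refine ⟨_, isSpanning_base hα (P := X 0) (Y := X 1) (Z := X 2) (X_ne_zero _)
      (by simpa using .X 0) (by simpa using .X 1) (by simpa using .X 2) ?_ ?_ ?_ ?_ hn⟩
    · intro J t h1 h2 hL f hf
      refine (Ideal.span_le.mpr ?_ : Ideal.span (Set.range X) ≤ J) (mem_span_range_X hf)
      have h0 : X 0 ∈ J := by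
        have := J.sub_mem (J.sub_mem hL (J.mul_mem_left (C t) h1)) (J.mul_mem_left (C (t ^ 2)) h2)
        convert this using 1
        rw [lineForm]
        ring
      rintro _ ⟨i, rfl⟩
      fin_cases i
      exacts [h0, h1, h2]
    · refine Eventually.of_forall fun t => ?_
      filter_upwards [eventually_affine_ne_zero (a := -t) (b := -1) (by simp)] with t' ht'
      convert ht' using 1
      simp [linePoint]
      ring
    · intro c hc
      refine Eventually.of_forall fun t => ?_
      filter_upwards [eventually_affine_ne_zero (a := 1 - c * t) (b := -c) (by simp [hc])] with t' ht'
      convert ht' using 1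
      simp [linePoint]
      ring
    · filter_upwards [eventually_affine_ne_zero (a := 1) (b := -1) (by simp)] with t ht
      filter_upwards [eventually_affine_ne_zero (a := 1 - t) (b := t - 1) (Or.inl (by
        convert ht using 1; ring))] with t' ht'
      convert ht' using 1
      simp [linePoint]
      ring

end BaseForms

section Spanning

variable {n : ℕ}

lemma sum_fin_two_mul {M : Type*} [AddCommMonoid M] (f : Fin (2*n) → M) :
    ∑ l, f l = ∑ i : Fin n, (f ⟨2*i.1, by have := i.2; omega⟩ +
      f ⟨2*i.1+1, by have := i.2; omega⟩) := by
  rw [← (pairEquiv n).sum_comp, Fintype.sum_prod_type]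
  refine Finset.sum_congr rfl fun i _ => ?_
  rw [Fin.sum_univ_two, pairEquiv_zero, pairEquiv_one]

lemma sum_baseDeg (hn : 0 < n) (α : ℕ) : ∑ i, baseDeg n α i = 2 * α := by
  rw [sum_fin_two_mul, Finset.sum_eq_single (⟨0, hn⟩ : Fin n)]
  · simp [baseDeg, two_mul]
  · intro i _ hi
    have : i.1 ≠ 0 := fun h => hi (Fin.ext h)
    simp [baseDeg, this]
  · simp

lemma IsSpanning.raise_multiset {G : Matrix (Fin (2*n)) (Fin (2*n)) (MvPolynomial (Fin 3) ℂ)}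
    {a : Fin (2*n) → ℤ} {d : ℕ} (h : IsSpanning G a d) (s : Multiset (Fin (2*n))) :
    ∃ G', IsSpanning (n := n) G' (fun i => a i + 2 * s.count i) (d + s.card) := by
  induction s using Multiset.induction with
  | empty => exact ⟨G, by simpa using h⟩
  | cons x s ih =>
    obtain ⟨G₁, h₁⟩ := ih
    obtain ⟨G₂, h₂⟩ := h₁.raise x
    refine ⟨G₂, ?_⟩
    convert h₂ using 1
    · ext i
      by_cases hi : i = x
      · subst hi
        simp
        ring
      · simp [hi]
    · simp [add_assoc]

/-- Spanning matrices exist for all non-negative half-degrees of constant parity. -/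
lemma exists_isSpanning (hn : 0 < n) {a : Fin (2*n) → ℕ} {α d : ℕ} (hα : α ≤ 1)
    (ha : ∀ i, a i % 2 = α) (hd : ∑ i, a i = 2 * d) :
    ∃ G, IsSpanning (n := n) G (fun i => (a i : ℤ)) d := by
  have hb : ∀ i, ∃ b : ℕ, (a i : ℤ) = baseDeg n α i + 2 * b := by
    intro i
    have := ha i
    unfold baseDeg
    split_ifs
    · exact ⟨a i / 2, by omega⟩
    · exact ⟨a i / 2, by omega⟩
    · exact ⟨a i / 2 + α, by omega⟩
  choose b hb using hb
  obtain ⟨G₀, h₀⟩ := exists_isSpanning_base hn hα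
  obtain ⟨G, h⟩ := h₀.raise_multiset (Finsupp.toMultiset (Finsupp.equivFunOnFinite.symm b))
  refine ⟨G, ?_⟩
  convert h using 1
  · ext i
    simp [hb]
  · have h1 : ∑ i, (a i : ℤ) = 2 * d := by exact_mod_cast hd
    simp_rw [hb, Finset.sum_add_distrib, sum_baseDeg hn, ← Finset.mul_sum] at h1
    rw [Finsupp.card_toMultiset, Finsupp.sum_fintype _ _ (by simp)]
    simp
    exact_mod_cast (by linarith : (d : ℤ) = α + ∑ i, (b i : ℤ))

variable {A : Matrix (Fin (2*n)) (Fin (2*n)) ℕ}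

lemma two_mul_apply_of_homogMat (hsym : A.IsSymm) (hhom : HomogMat A) (i j : Fin (2*n)) :
    2 * A i j = A i i + A j j := by
  have h1 := hhom i i j j
  have h2 : A j i = A i j := hsym.apply i j
  omega

/-- A general skew-symmetric matrix with degree matrix `A`: every form of the degree of its
Pfaffian is a first-order variation of the Pfaffian. -/
lemma exists_dpf_eq (hn : 0 < n) (hsym : A.IsSymm) (hhom : HomogMat A) {d : ℕ}
    (htr : A.trace = 2 * d) :
    ∃ G : Matrix (Fin (2*n)) (Fin (2*n)) (MvPolynomial (Fin 3) ℂ), IsSkew G ∧ DegMat G A ∧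
      ∀ f : MvPolynomial (Fin 3) ℂ, f.IsHomogeneous d →
        ∃ H, IsSkew H ∧ DegMat H A ∧ dpf G H = f := by
  have hA := two_mul_apply_of_homogMat hsym hhom
  obtain ⟨G, hG⟩ := exists_isSpanning hn (a := fun i => A i i)
    (α := A ⟨0, by omega⟩ ⟨0, by omega⟩ % 2) (d := d) (by omega)
    (fun i => by have := hA i ⟨0, by omega⟩; omega) (by simpa [Matrix.trace] using htr)
  have hdeg : ∀ i j, ((A i i : ℤ) + A j j) = 2 * (A i j : ℕ) := fun i j => by
    exact_mod_cast (hA i j).symm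
  refine ⟨G, hG.skew, fun i j => (hG.entry_degree i j).isHomogeneous (hdeg i j),
    fun f hf => ?_⟩
  obtain ⟨h, hh, hfh⟩ := exists_homogeneous_coeffs
    (fun p : Fin (2*n) × Fin (2*n) => hG.subPf_degree p.1 p.2) hf (hG.full f hf)
  have hh' : ∀ p, (h p).IsHomogeneous (A p.1 p.2) := fun p =>
    (hh p).isHomogeneous (by rw [← hdeg]; ring)
  refine ⟨∑ p, h p • wedge (Pi.single p.1 1) (Pi.single p.2 1), fun i j => ?_, fun i j => ?_, ?_⟩
  · simp only [Matrix.sum_apply, ← Finset.sum_neg_distrib]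
    refine Finset.sum_congr rfl fun p _ => ?_
    simp [wedge, Matrix.vecMulVec_apply]
    ring
  · rw [Matrix.sum_apply]
    refine IsHomogeneous.sum _ _ _ fun p _ => ?_
    simp only [Matrix.smul_apply, smul_eq_mul, wedge, Matrix.sub_apply, Matrix.vecMulVec_apply,
      Pi.single_apply, mul_sub]
    refine .sub ?_ ?_
    · by_cases hp : i = p.1 ∧ j = p.2
      · simpa [hp.1, hp.2] using hh' p
      · rw [show h p * _ = 0 by grind]
        exact isHomogeneous_zero _ _ _
    · by_cases hp : i = p.2 ∧ j = p.1
      · have := hsym.apply p.1 p.2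
        simpa [hp.1, hp.2, this] using hh' p
      · rw [show h p * _ = 0 by grind]
        exact isHomogeneous_zero _ _ _
  · rw [hfh]
    change dpfLin G _ = _
    rw [map_sum]
    simp only [map_smul]
    rfl

lemma isHomogeneous_pf {M : Matrix (Fin (2*n)) (Fin (2*n)) (MvPolynomial (Fin 3) ℂ)}
    (hsym : A.IsSymm) (hhom : HomogMat A) {d : ℕ} (htr : A.trace = 2 * d) (hM : DegMat M A) :
    (pf M).IsHomogeneous d := by
  rw [pf, smul_eq_C_mul, ← zero_add d]
  refine (isHomogeneous_C _ _).mul (IsHomogeneous.sum _ _ _ fun p _ => ?_)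
  rw [← Int.cast_smul_eq_zsmul ℂ, smul_eq_C_mul, ← zero_add d]
  refine (isHomogeneous_C _ _).mul ?_
  convert IsHomogeneous.prod Finset.univ _ _ fun (i : Fin n) _ =>
    hM (p ⟨2*i.1, by have := i.2; omega⟩) (p ⟨2*i.1+1, by have := i.2; omega⟩)
  have h := sum_fin_two_mul fun l => A (p l) (p l)
  rw [Equiv.sum_comp p fun l => A l l] at h
  have ht : ∑ l, A l l = 2 * d := by simpa [Matrix.trace] using htr
  simp only [← two_mul_apply_of_homogMat hsym hhom, ← Finset.mul_sum] at h
  omega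

end Spanning

section Dominance

variable {σ : Type*} [Fintype σ]

lemma pderiv_aeval {τ : Type*} (φ : σ → MvPolynomial τ ℂ) (P : MvPolynomial σ ℂ) (j : τ) :
    pderiv j (aeval φ P) = ∑ i, pderiv j (φ i) * aeval φ (pderiv i P) := by
  classical
  induction P using MvPolynomial.induction_on with
  | C c => simp
  | add p q hp hq => simp only [map_add, hp, hq, mul_add, Finset.sum_add_distrib]
  | mul_X p k hp =>
    simp only [map_mul, aeval_X, Derivation.leibniz, smul_eq_mul, hp, pderiv_X, map_add, mul_add,
      Finset.sum_add_distrib, Finset.mul_sum]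
    congr 1
    · simp [Pi.single_apply, mul_comm]
    · exact Finset.sum_congr rfl fun i _ => by ring

/-- Polynomials with invertible Jacobian at the origin are algebraically independent. -/
lemma algebraicIndependent_of_pderiv [DecidableEq σ] {φ : σ → MvPolynomial σ ℂ}
    (hφ : ∀ i j, eval 0 (pderiv j (φ i)) = if i = j then 1 else 0) :
    AlgebraicIndependent ℂ φ := by
  set J : Matrix σ σ (MvPolynomial σ ℂ) := Matrix.of fun j i => pderiv j (φ i)
  have hJ : J.det ≠ 0 := by
    intro h
    have h1 : (eval (0 : σ → ℂ)).mapMatrix J = 1 := by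
      ext i j
      simp only [RingHom.mapMatrix_apply, Matrix.map_apply, J, Matrix.of_apply, hφ,
        Matrix.one_apply, eq_comm]
    have h2 := congrArg (eval (0 : σ → ℂ)) h
    rw [RingHom.map_det, h1] at h2
    simp at h2
  have key : ∀ (N : ℕ) (P : MvPolynomial σ ℂ), aeval φ P = 0 →
      (∀ m : σ →₀ ℕ, N ≤ m.degree → coeff m P = 0) → P = 0 := by
    intro N
    induction N with
    | zero => exact fun P _ h => by ext m; simpa using h m (Nat.zero_le _)
    | succ N ih =>
      intro P hP hdeg
      have hv : (fun i => aeval φ (pderiv i P)) = 0 := by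
        refine Matrix.eq_zero_of_mulVec_eq_zero hJ ?_
        ext1 j
        have h := pderiv_aeval φ P j
        rw [hP, map_zero] at h
        exact h.symm
      have hpd : ∀ i, pderiv i P = 0 := fun i => ih _ (congrFun hv i) fun m hm => by
        rw [coeff_pderiv, hdeg _ (by simpa using hm), zero_mul]
      have hC : P = C (coeff 0 P) := by
        ext m
        rw [coeff_C]
        split_ifs with hm
        · rw [hm]
        · obtain ⟨i, hi⟩ := Finsupp.ne_iff.mp (Ne.symm hm)
          have hmi : m = m - Finsupp.single i 1 + Finsupp.single i 1 :=
            (tsub_add_cancel_of_le (Finsupp.single_le_iff.mpr (Nat.pos_of_ne_zero hi))).symm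
          have h := congrArg (coeff (m - Finsupp.single i 1)) (hpd i)
          rw [coeff_pderiv, ← hmi, coeff_zero] at h
          exact (mul_eq_zero.mp h).resolve_right (Nat.cast_add_one_ne_zero _)
      rw [hC] at hP ⊢
      simpa using hP
  refine (injective_iff_map_eq_zero _).mpr fun P hP =>
    key (P.totalDegree + 1) P hP fun m hm => coeff_eq_zero_of_totalDegree_lt ?_
  exact hm

/-- Lying over for an extension that becomes integral after inverting `r`. -/
lemma Ideal.map_ne_top_of_isIntegral_smul {A B : Type*} [CommRing A] [CommRing B] [Algebra A B]
    [FaithfulSMul A B] {I : Ideal A} [hI : I.IsMaximal] {r : A} (hr : r ∉ I)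
    (hpow : ∀ b : B, ∃ N : ℕ, IsIntegral A (r ^ N • b)) : I.map (algebraMap A B) ≠ ⊤ := by
  obtain ⟨Q, hQ, hQI⟩ := Ideal.exists_ideal_over_maximal_of_isIntegral
    (S := integralClosure A B) I
    (fun a ha => by
      have h : algebraMap A B a = 0 := congrArg Subtype.val ((RingHom.mem_ker).mp ha)
      rw [(FaithfulSMul.algebraMap_eq_zero_iff A B).mp h]
      exact I.zero_mem)
  have hmem : ∀ b ∈ I.map (algebraMap A B), ∃ N : ℕ, ∃ c ∈ Q, (c : B) = r ^ N • b := by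
    intro b hb
    induction hb using Submodule.span_induction with
    | mem b hb =>
      obtain ⟨a, ha, rfl⟩ := hb
      refine ⟨0, algebraMap A _ a, ?_, by rw [pow_zero, one_smul]; rfl⟩
      rw [← hQI] at ha
      exact ha
    | zero => exact ⟨0, 0, Q.zero_mem, by simp⟩
    | add p q _ _ hp hq =>
      obtain ⟨N, c, hc, hcp⟩ := hp
      obtain ⟨M, e, he, heq⟩ := hq
      refine ⟨N + M, r ^ M • c + r ^ N • e, Q.add_mem (Submodule.smul_of_tower_mem _ _ hc)
        (Submodule.smul_of_tower_mem _ _ he), ?_⟩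
      push_cast
      rw [hcp, heq, smul_add, pow_add, mul_smul (r ^ N) _ q, smul_smul, mul_comm (r ^ M)]
    | smul a p _ hp =>
      obtain ⟨N, c, hc, hcp⟩ := hp
      obtain ⟨M, hM⟩ := hpow a
      refine ⟨M + N, ⟨_, hM⟩ * c, Q.mul_mem_left _ hc, ?_⟩
      push_cast
      rw [hcp, smul_eq_mul, pow_add, smul_mul_smul_comm]
  intro htop
  obtain ⟨N, c, hc, hcN⟩ := hmem 1 (htop ▸ Submodule.mem_top)
  have hc' : c = algebraMap A _ (r ^ N) :=
    Subtype.ext (hcN.trans ((Algebra.smul_def _ _).trans (mul_one _)))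
  rw [hc', ← Ideal.mem_comap, hQI] at hc
  exact hr (hI.isPrime.mem_of_pow_mem _ hc)

/-- A map `ℂ^σ → ℂ^σ` with algebraically independent components has image containing a nonempty
principal open set. -/
lemma exists_forall_exists_eval_eq {φ : σ → MvPolynomial σ ℂ} (hφ : AlgebraicIndependent ℂ φ) :
    ∃ P : MvPolynomial σ ℂ, P ≠ 0 ∧
      ∀ y, eval y P ≠ 0 → ∃ u, ∀ i, eval u (φ i) = y i := by
  classical
  let A := Algebra.adjoin ℂ (Set.range φ)
  have htb : IsTranscendenceBasis ℂ φ :=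
    hφ.isTranscendenceBasis_of_lift_trdeg_le_of_finite (by simp [MvPolynomial.trdeg_of_isDomain])
  have halg : Algebra.IsAlgebraic A (MvPolynomial σ ℂ) := htb.isAlgebraic
  obtain ⟨r, hr, hrX⟩ := halg.exists_integral_multiples A (Finset.univ.image (X (R := ℂ)))
  have hpow : ∀ b : MvPolynomial σ ℂ, ∃ N : ℕ, IsIntegral A (r ^ N • b) := by
    intro b
    induction b using MvPolynomial.induction_on with
    | C c => exact ⟨0, by
        rw [pow_zero, one_smul]
        exact isIntegral_algebraMap (R := A) (x := algebraMap ℂ A c)⟩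
    | add p q hp hq =>
      obtain ⟨N, hN⟩ := hp
      obtain ⟨M, hM⟩ := hq
      refine ⟨N + M, ?_⟩
      rw [smul_add, pow_add, mul_smul (r ^ N) _ q, mul_comm, mul_smul]
      exact (hN.smul _).add (hM.smul _)
    | mul_X p k hp =>
      obtain ⟨N, hN⟩ := hp
      refine ⟨N + 1, ?_⟩
      rw [pow_succ, mul_smul, ← mul_smul_comm, ← smul_mul_assoc]
      exact hN.mul (hrX _ (by simp))
  refine ⟨hφ.aevalEquiv.symm r, by simpa using hr, fun y hy => ?_⟩
  let χ : A →ₐ[ℂ] ℂ := (aeval y).comp hφ.aevalEquiv.symm.toAlgHom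
  have hχ : Function.Surjective χ := fun c => ⟨algebraMap ℂ A c, by simp⟩
  have hχr : r ∉ RingHom.ker χ := hy
  have : (RingHom.ker χ).IsMaximal := RingHom.ker_isMaximal_of_surjective χ hχ
  have hne := Ideal.map_ne_top_of_isIntegral_smul hχr hpow
  obtain ⟨M, hM, hle⟩ := Ideal.exists_le_maximal _ hne
  obtain ⟨u, rfl⟩ := isMaximal_iff_eq_vanishingIdeal_singleton.mp hM
  refine ⟨u, fun i => ?_⟩
  have hi : hφ.aevalEquiv (X i - C (y i)) ∈ RingHom.ker χ := by simp [χ]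
  have h := hle (Ideal.mem_map_of_mem _ hi)
  rw [mem_vanishingIdeal_singleton_iff] at h
  simpa [sub_eq_zero] using h

end Dominance

section Coefficients

variable {σ : Type*}

lemma aeval_eps [DecidableEq σ] (j : σ) (p : MvPolynomial σ ℂ) :
    aeval (fun i => if i = j then (DualNumber.eps : DualNumber (MvPolynomial (Fin 3) ℂ)) else 0) p =
      TrivSqZeroExt.inl (C (eval 0 p)) + TrivSqZeroExt.inr (C (eval 0 (pderiv j p))) := by
  induction p using MvPolynomial.induction_on with
  | C c =>
    rw [← algebraMap_eq, AlgHom.commutes]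
    ext1
    · simp
      rfl
    · simp
      rfl
  | add p q hp hq =>
    rw [map_add, hp, hq]
    ext1 <;> simp
  | mul_X p k hp =>
    rw [map_mul, hp, aeval_X, pderiv_mul, pderiv_X]
    split_ifs with h
    · subst h
      ext1 <;> simp
    · ext1 <;> simp [Ne.symm h]

/-- The homomorphism to dual numbers recording the first-order dependence on the `j`-th parameter
of a form whose coefficients are polynomials in the parameters. -/
noncomputable def firstOrder [DecidableEq σ] (j : σ) :
    MvPolynomial (Fin 3) (MvPolynomial σ ℂ) →ₐ[ℂ] DualNumber (MvPolynomial (Fin 3) ℂ) :=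
  aevalTower (aeval fun i => if i = j then DualNumber.eps else 0)
    (fun i => TrivSqZeroExt.inl (X i))

lemma coeff_snd_firstOrder [DecidableEq σ] (j : σ)
    (q : MvPolynomial (Fin 3) (MvPolynomial σ ℂ)) (m : Fin 3 →₀ ℕ) :
    coeff m (firstOrder j q).snd = eval 0 (pderiv j (coeff m q)) := by
  induction q using MvPolynomial.induction_on' with
  | add p q hp hq => simp only [map_add, TrivSqZeroExt.snd_add, coeff_add, hp, hq]
  | monomial n a =>
    have h : firstOrder j (monomial n a) =
        (TrivSqZeroExt.inl (C (eval 0 a)) + TrivSqZeroExt.inr (C (eval 0 (pderiv j a)))) *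
          TrivSqZeroExt.inl (monomial n 1) := by
      rw [← aeval_eps, monomial_eq, monomial_eq, map_mul, firstOrder, aevalTower_C, Finsupp.prod,
        map_prod, C_1, one_mul, Finsupp.prod, ← TrivSqZeroExt.inlHom_apply, map_prod]
      simp [TrivSqZeroExt.inlHom_apply]
    rw [h]
    rw [coeff_monomial]
    split_ifs with hm <;> simp [hm]

variable {n : ℕ}

/-- The universal linear combination of `G` and the matrices `H i`. -/
noncomputable def universalMat [Fintype σ]
    (G : Matrix (Fin (2*n)) (Fin (2*n)) (MvPolynomial (Fin 3) ℂ))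
    (H : σ → Matrix (Fin (2*n)) (Fin (2*n)) (MvPolynomial (Fin 3) ℂ)) :
    Matrix (Fin (2*n)) (Fin (2*n)) (MvPolynomial (Fin 3) (MvPolynomial σ ℂ)) :=
  fun a b => map C (G a b) + ∑ i, C (X i) * map C (H i a b)

variable [Fintype σ] (G : Matrix (Fin (2*n)) (Fin (2*n)) (MvPolynomial (Fin 3) ℂ))
  (H : σ → Matrix (Fin (2*n)) (Fin (2*n)) (MvPolynomial (Fin 3) ℂ))

lemma map_firstOrder_universalMat [DecidableEq σ] (j : σ) :
    (universalMat G H).map (firstOrder j) = dualMat G (H j) := by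
  have h1 : ∀ f : MvPolynomial (Fin 3) ℂ, firstOrder j (map C f) = TrivSqZeroExt.inl f := by
    intro f
    have : ((firstOrder j).comp (mapAlgHom (Algebra.ofId ℂ (MvPolynomial σ ℂ)))) =
        TrivSqZeroExt.inlAlgHom ℂ (MvPolynomial (Fin 3) ℂ) (MvPolynomial (Fin 3) ℂ) := by
      refine algHom_ext fun i => ?_
      simp [firstOrder]
    exact DFunLike.congr_fun this f
  have h2 : ∀ i, firstOrder j (C (X i)) =
      if i = j then (DualNumber.eps : DualNumber (MvPolynomial (Fin 3) ℂ)) else 0 := by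
    intro i
    rw [firstOrder, aevalTower_C, aeval_X]
  ext1 a b
  simp only [universalMat, Matrix.map_apply, dualMat, map_add, map_sum, map_mul, h1, h2, ite_mul,
    zero_mul, Finset.sum_ite_eq', Finset.mem_univ, if_true]
  ext1 <;> simp

lemma coeff_pf_add_sum (u : σ → ℂ) (m : Fin 3 →₀ ℕ) :
    coeff m (pf (G + ∑ i, u i • H i)) = eval u (coeff m (pf (universalMat G H))) := by
  have h : G + ∑ i, u i • H i = (universalMat G H).map (mapAlgHom (aeval (R := ℂ) u)) := by
    have h1 : ∀ f : MvPolynomial (Fin 3) ℂ, mapAlgHom (aeval (R := ℂ) u) (map C f) = f := by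
      intro f
      rw [mapAlgHom_apply, map_map]
      convert map_id f
      ext; simp
    ext1 a b
    simp only [universalMat, Matrix.map_apply, map_add, map_sum, map_mul, h1, Matrix.add_apply,
      Matrix.sum_apply, Matrix.smul_apply, smul_eq_C_mul]
    simp
  rw [h, pf_map, mapAlgHom_apply, coeff_map]
  simp

lemma exists_pf_eq_of_dpf [DecidableEq σ] (e : σ ↪ (Fin 3 →₀ ℕ))
    (hH : ∀ i, dpf G (H i) = monomial (e i) 1) :
    ∃ P : MvPolynomial σ ℂ, P ≠ 0 ∧ ∀ y, eval y P ≠ 0 →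
      ∃ u : σ → ℂ, ∀ i, coeff (e i) (pf (G + ∑ i, u i • H i)) = y i := by
  simp_rw [coeff_pf_add_sum]
  refine exists_forall_exists_eval_eq (algebraicIndependent_of_pderiv fun i j => ?_)
  rw [← coeff_snd_firstOrder, ← pf_map, map_firstOrder_universalMat, snd_pf_dualMat, hH,
    coeff_monomial]
  simp [eq_comm]

end Coefficients

/-- Let `A` be a non-negative symmetric homogeneous integer matrix of
even size `2k × 2k` with trace `2d`. Then a general form of degree `d` in three variables
is the Pfaffian of a skew-symmetric `2k × 2k` matrix of forms with degree matrix `A`.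
Genericity is expressed by a nonzero polynomial `P` in the coefficients of the form,
cutting out a nonempty Zariski-open subset of the space of forms of degree `d`. -/
theorem general_ternary_form_is_pfaffian
    (k d : ℕ) (hk : 0 < k)
    (A : Matrix (Fin (2*k)) (Fin (2*k)) ℕ) (hsym : A.IsSymm) (hhom : HomogMat A)
    (htr : Matrix.trace A = 2 * d) :
    ∃ P : MvPolynomial ((Fin 3) →₀ ℕ) ℂ, P ≠ 0 ∧
      (∃ F : MvPolynomial (Fin 3) ℂ, F.IsHomogeneous d ∧
        MvPolynomial.eval (fun m => MvPolynomial.coeff m F) P ≠ 0) ∧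
      ∀ F : MvPolynomial (Fin 3) ℂ, F.IsHomogeneous d →
        MvPolynomial.eval (fun m => MvPolynomial.coeff m F) P ≠ 0 →
        ∃ G : Matrix (Fin (2*k)) (Fin (2*k)) (MvPolynomial (Fin 3) ℂ),
          IsSkew G ∧ DegMat G A ∧ F = pfaff G := by
  classical
  let σ := {m : Fin 3 →₀ ℕ // m.degree = d}
  have : Finite σ := (Finsupp.finite_of_degree_le (σ := Fin 3) d).subset fun m hm => le_of_eq hm
  have : Fintype σ := Fintype.ofFinite σ
  obtain ⟨G, hG, hGA, hdpf⟩ := exists_dpf_eq (by omega) hsym hhom htr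
  choose H hH hHA hGH using fun i : σ => hdpf (monomial i.1 1) (isHomogeneous_monomial _ i.2)
  obtain ⟨P, hP, hPu⟩ := exists_pf_eq_of_dpf G H (Function.Embedding.subtype _) hGH
  have hrename : ∀ F : MvPolynomial (Fin 3) ℂ, eval (fun m => coeff m F) (rename Subtype.val P) =
      eval (fun i : σ => coeff i.1 F) P := fun F => eval_rename _ _ _
  refine ⟨rename Subtype.val P, ?_, ?_, fun F hF hPF => ?_⟩
  · exact fun h => hP (rename_injective _ Subtype.val_injective (h.trans (map_zero _).symm))
  · obtain ⟨y, hy⟩ : ∃ y, eval y P ≠ 0 := by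
      by_contra! h
      exact hP (MvPolynomial.funext fun y => by rw [h, map_zero])
    refine ⟨∑ i : σ, monomial i.1 (y i),
      IsHomogeneous.sum _ _ _ fun i _ => isHomogeneous_monomial _ i.2, ?_⟩
    rw [hrename]
    convert hy
    rw [coeff_sum, Finset.sum_eq_single _ _ (by simp)]
    · exact by rw [coeff_monomial, if_pos rfl]
    · exact fun i _ hi => by rw [coeff_monomial, if_neg (Subtype.val_injective.ne hi)]
  · rw [hrename] at hPF
    obtain ⟨u, hu⟩ := hPu _ hPF
    have hdeg : DegMat (G + ∑ i, u i • H i) A := by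
      intro a b
      simp only [Matrix.add_apply, Matrix.sum_apply, Matrix.smul_apply, smul_eq_C_mul]
      refine (hGA a b).add (IsHomogeneous.sum _ _ _ fun i _ => ?_)
      simpa using (isHomogeneous_C _ (u i)).mul (hHA i a b)
    refine ⟨G + ∑ i, u i • H i, fun a b => ?_, hdeg, ?_⟩
    · simp only [Matrix.add_apply, Matrix.sum_apply, Matrix.smul_apply, hG a b, hH _ a b,
        smul_neg, Finset.sum_neg_distrib, neg_add]
    · ext m
      by_cases hm : m.degree = d
      · exact (hu ⟨m, hm⟩).symm
      · exact (hF.coeff_eq_zero hm).trans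
          ((isHomogeneous_pf hsym hhom htr hdeg).coeff_eq_zero hm).symm
end
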